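/- arXiv:1501.00441 — 3 statements merged into one kernel-verified Lean document; each statement's English description precedes it below -/
import Mathlib

section
/- Let Ω ⊂ ℝ² be a bounded open set with smooth boundary, and for each i let V_i, W_i : Ω̄ → ℝ and u_i, v_i ∈ C²(Ω̄) satisfy -Δu_i = V_i e^{v_i} and -Δv_i = W_i e^{u_i} in Ω, u_i = 0 and v_i = 0 on ∂Ω, with 0 ≤ V_i ≤ b₁, 0 ≤ W_i ≤ b₂, ∫_Ω e^{u_i} dx ≤ C₁, ∫_Ω e^{v_i} dx ≤ C₂. Suppose V_i e^{v_i} dx → μ₁ and W_i e^{u_i} dx → μ₂ weakly-* as nonnegative finite measures on Ω̄, and let x₀ ∈ ∂Ω be a boundary point such that μ₁({x₀}) < 4π or μ₂({x₀}) < 4π. Then there exist R > 0 and a constant C such that ‖u_i‖_{L^∞(B_R(x₀) ∩ Ω̄)} ≤ C and ‖v_i‖_{L^∞(B_R(x₀) ∩ Ω̄)} ≤ C for all i. -/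
open MeasureTheory Real Filter Topology Metric Set
open scoped RealInnerProductSpace ENNReal NNReal

noncomputable section

abbrev E2 : Type := EuclideanSpace ℝ (Fin 2)

/-- The Laplacian `Δ = ∂₁₁ + ∂₂₂` on `ℝ²`. -/
noncomputable def lap (u : E2 → ℝ) (x : E2) : ℝ :=
  ∑ i : Fin 2,
    fderiv ℝ (fun y => fderiv ℝ u y (EuclideanSpace.single i 1)) x (EuclideanSpace.single i 1)

/-- A planar set has smooth boundary: near each boundary point the set is the sublevel set
of a smooth local defining function with nonvanishing derivative. -/
def SmoothBoundary (Ω : Set E2) : Prop :=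
  ∀ x ∈ frontier Ω, ∃ (U : Set E2) (f : E2 → ℝ),
    IsOpen U ∧ x ∈ U ∧ ContDiff ℝ (⊤ : ℕ∞) f ∧ (∀ y ∈ U, fderiv ℝ f y ≠ 0) ∧
    Ω ∩ U = {y ∈ U | f y < 0} ∧ frontier Ω ∩ U = {y ∈ U | f y = 0}


/-- second-order line derivatives along the coordinate directions, summing to `l`. -/
def HasLap (w : E2 → ℝ) (x : E2) (l : ℝ) : Prop :=
  ∃ g : Fin 2 → ℝ → ℝ, ∃ h : Fin 2 → ℝ,
    (∀ i, ∀ᶠ t in 𝓝 (0:ℝ),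
      HasDerivAt (fun s : ℝ => w (x + s • EuclideanSpace.single i (1:ℝ))) (g i t) t) ∧
    (∀ i, HasDerivAt (g i) (h i) 0) ∧ l = h 0 + h 1

lemma HasLap.add {w₁ w₂ : E2 → ℝ} {x : E2} {l₁ l₂ : ℝ} (h₁ : HasLap w₁ x l₁)
    (h₂ : HasLap w₂ x l₂) : HasLap (fun y => w₁ y + w₂ y) x (l₁ + l₂) := by
  obtain ⟨g₁, k₁, a₁, b₁, c₁⟩ := h₁
  obtain ⟨g₂, k₂, a₂, b₂, c₂⟩ := h₂
  refine ⟨fun i t => g₁ i t + g₂ i t, fun i => k₁ i + k₂ i, fun i => ?_, fun i => ?_, ?_⟩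
  · filter_upwards [a₁ i, a₂ i] with t h1 h2
    exact h1.add h2
  · exact (b₁ i).add (b₂ i)
  · rw [c₁, c₂]; ring

lemma HasLap.const_mul {w : E2 → ℝ} {x : E2} {l : ℝ} (c : ℝ) (h : HasLap w x l) :
    HasLap (fun y => c * w y) x (c * l) := by
  obtain ⟨g₁, k₁, a₁, b₁, c₁⟩ := h
  refine ⟨fun i t => c * g₁ i t, fun i => c * k₁ i, fun i => ?_, fun i => ?_, ?_⟩
  · filter_upwards [a₁ i] with t h1
    exact h1.const_mul c
  · exact (b₁ i).const_mul c
  · rw [c₁]; ring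

lemma second_deriv_nonpos {φ g : ℝ → ℝ} {h : ℝ} (hmax : IsLocalMax φ 0)
    (h1 : ∀ᶠ t in 𝓝 (0:ℝ), HasDerivAt φ (g t) t) (h2 : HasDerivAt g h 0) : h ≤ 0 := by
  by_contra hh
  push Not at hh
  have e1 : deriv φ =ᶠ[𝓝 0] g := h1.mono fun t ht => ht.deriv
  have e2 : deriv (deriv φ) 0 = h := by rw [e1.deriv_eq, h2.deriv]
  have hmin : IsLocalMin φ 0 := isLocalMin_of_deriv_deriv_pos (by rw [e2]; exact hh)
    hmax.deriv_eq_zero h1.self_of_nhds.continuousAt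
  have e3 : φ =ᶠ[𝓝 0] fun _ => φ 0 := by
    filter_upwards [hmax, hmin] with t a b
    exact le_antisymm a b
  have e4 : deriv φ =ᶠ[𝓝 0] fun _ => 0 := by
    have := e3.deriv
    simpa using this
  have e5 : deriv (deriv φ) 0 = 0 := by rw [e4.deriv_eq]; simp
  linarith

lemma HasLap.nonpos_of_isLocalMax {w : E2 → ℝ} {x : E2} {l : ℝ} (h : HasLap w x l)
    (hmax : IsLocalMax w x) : l ≤ 0 := by
  obtain ⟨g, k, a, b, c⟩ := h
  have key : ∀ i, k i ≤ 0 := fun i => by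
    refine second_deriv_nonpos (φ := fun s : ℝ => w (x + s • EuclideanSpace.single i (1:ℝ)))
      ?_ (a i) (b i)
    have hc : ContinuousAt (fun s : ℝ => x + s • (EuclideanSpace.single i (1:ℝ) : E2)) 0 := by
      fun_prop
    have hc' : Tendsto (fun s : ℝ => x + s • (EuclideanSpace.single i (1:ℝ) : E2)) (𝓝 0) (𝓝 x) := by
      have := hc.tendsto
      simpa using this
    have := hc'.eventually hmax
    filter_upwards [this] with t ht
    simpa using ht
  rw [c]; linarith [key 0, key 1]

lemma hasLap_lap {u : E2 → ℝ} {Ω : Set E2} (hΩ : IsOpen Ω) (hu : ContDiffOn ℝ 2 u Ω) {x : E2}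
    (hx : x ∈ Ω) : HasLap u x (lap u x) := by
  have hd : ∀ y ∈ Ω, DifferentiableAt ℝ u y := fun y hy =>
    (hu.contDiffAt (hΩ.mem_nhds hy)).differentiableAt (by norm_num)
  have hd2 : DifferentiableAt ℝ (fderiv ℝ u) x :=
    ((hu.contDiffAt (hΩ.mem_nhds hx)).fderiv_right (m := 1) (by norm_num)).differentiableAt
      (by norm_num)
  have hl : ∀ (i : Fin 2) (t : ℝ), HasDerivAt
      (fun s : ℝ => x + s • (EuclideanSpace.single i (1:ℝ) : E2)) (EuclideanSpace.single i (1:ℝ)) t := by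
    intro i t
    have := ((hasDerivAt_id t).smul_const (EuclideanSpace.single i (1:ℝ) : E2)).const_add x
    simpa using this
  refine ⟨fun i t => fderiv ℝ u (x + t • EuclideanSpace.single i (1:ℝ)) (EuclideanSpace.single i 1),
    fun i => fderiv ℝ (fun y => fderiv ℝ u y (EuclideanSpace.single i 1)) x
      (EuclideanSpace.single i 1), fun i => ?_, fun i => ?_, ?_⟩
  · have hc' : Tendsto (fun s : ℝ => x + s • (EuclideanSpace.single i (1:ℝ) : E2)) (𝓝 0) (𝓝 x) := by
      have := (hl i 0).continuousAt.tendsto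
      simpa using this
    filter_upwards [hc'.eventually (hΩ.mem_nhds hx)] with t ht
    exact (hd _ ht).hasFDerivAt.comp_hasDerivAt t (hl i t)
  · have h1 : DifferentiableAt ℝ (fun y => fderiv ℝ u y (EuclideanSpace.single i 1)) x :=
      hd2.clm_apply (by fun_prop)
    have h2 : HasFDerivAt (fun y => fderiv ℝ u y (EuclideanSpace.single i 1))
      (fderiv ℝ (fun y => fderiv ℝ u y (EuclideanSpace.single i 1)) x)
      (x + (0:ℝ) • (EuclideanSpace.single i (1:ℝ) : E2)) := by
      simpa using h1.hasFDerivAt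
    exact h2.comp_hasDerivAt (0:ℝ) (hl i 0)
  · simp [lap, Fin.sum_univ_two]

lemma lap_continuousOn {u : E2 → ℝ} {Ω : Set E2} (hΩ : IsOpen Ω) (hu : ContDiffOn ℝ 2 u Ω) :
    ContinuousOn (lap u) Ω := by
  intro x hx
  apply ContinuousAt.continuousWithinAt
  have h1 : ContDiffAt ℝ 1 (fderiv ℝ u) x :=
    (hu.contDiffAt (hΩ.mem_nhds hx)).fderiv_right (m := 1) (by norm_num)
  unfold lap
  refine tendsto_finsetSum _ fun i _ => ?_
  have h2 : ContDiffAt ℝ 1 (fun y => fderiv ℝ u y (EuclideanSpace.single i 1)) x :=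
    h1.clm_apply contDiffAt_const
  have h3 : ContDiffAt ℝ 0 (fderiv ℝ (fun y => fderiv ℝ u y (EuclideanSpace.single i 1))) x :=
    h2.fderiv_right (m := 0) (by norm_num)
  exact (h3.clm_apply contDiffAt_const).continuousAt

lemma norm_add_single_sq (z : E2) (s : ℝ) (i : Fin 2) :
    ‖z + s • (EuclideanSpace.single i (1:ℝ) : E2)‖ ^ 2 = ‖z‖ ^ 2 + 2 * s * z i + s ^ 2 := by
  rw [EuclideanSpace.norm_sq_eq, EuclideanSpace.norm_sq_eq]
  fin_cases i <;> simp [Fin.sum_univ_two] <;> ring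

lemma norm_sq_two (z : E2) : ‖z‖ ^ 2 = z 0 ^ 2 + z 1 ^ 2 := by
  rw [EuclideanSpace.norm_sq_eq]; simp [Fin.sum_univ_two]

lemma hasLap_norm_sq (x : E2) : HasLap (fun y => ‖y‖ ^ 2) x 4 := by
  refine ⟨fun i t => 2 * x i + 2 * t, fun _ => 2, fun i => ?_, fun i => ?_, by norm_num⟩
  · refine Eventually.of_forall fun t => ?_
    simp_rw [norm_add_single_sq]
    have h1 : HasDerivAt (fun s : ℝ => ‖x‖ ^ 2 + 2 * s * x i + s ^ 2)
      (2 * 1 * x i + 2 * t) t := by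
      have := ((((hasDerivAt_id t).const_mul 2).mul_const (x i)).const_add (‖x‖^2)).add
        ((hasDerivAt_id t).pow 2)
      refine (this.congr_deriv (by simp)).congr_of_eventuallyEq (Eventually.of_forall fun s => ?_)
      simp
    simpa using h1
  · have := ((hasDerivAt_id (0:ℝ)).const_mul 2).const_add (2 * x i)
    simpa using this

/-- minimum principle: superharmonic functions with zero boundary values are nonnegative. -/
lemma nonneg_of_lap {Ω : Set E2} (hΩo : IsOpen Ω) (hΩb : Bornology.IsBounded Ω) {u : E2 → ℝ}
    (hu : ContDiffOn ℝ 2 u (closure Ω)) (hl : ∀ x ∈ Ω, 0 ≤ -lap u x)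
    (hb : ∀ x ∈ frontier Ω, u x = 0) : ∀ x ∈ closure Ω, 0 ≤ u x := by
  intro x hx
  by_contra hneg
  push Not at hneg
  have hK : IsCompact (closure Ω) := hΩb.isCompact_closure
  obtain ⟨B, hB⟩ := hΩb.closure.exists_norm_le
  set κ : ℝ := -u x / (2 * (B ^ 2 + 1)) with hκ
  have hκ0 : 0 < κ := by apply div_pos (by linarith); positivity
  have hκB : κ * (B ^ 2 + 1) = -u x / 2 := by rw [hκ]; field_simp
  have hcont : ContinuousOn (fun y => (-1) * u y + κ * ‖y‖ ^ 2) (closure Ω) := by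
    have := hu.continuousOn
    fun_prop
  obtain ⟨y, hy, hmax⟩ := hK.exists_isMaxOn ⟨x, hx⟩ hcont
  have h1 : (-1) * u x + κ * ‖x‖ ^ 2 ≤ (-1) * u y + κ * ‖y‖ ^ 2 := hmax hx
  have hyΩ : y ∈ Ω := by
    by_contra hyn
    have hyf : y ∈ frontier Ω := by rw [hΩo.frontier_eq]; exact ⟨hy, hyn⟩
    rw [hb y hyf] at h1
    have : ‖y‖ ^ 2 ≤ B ^ 2 := by
      have := hB y hy
      gcongr
    nlinarith [sq_nonneg ‖x‖]
  have hlap := (((hasLap_lap hΩo (hu.mono subset_closure) hyΩ).const_mul (-1)).add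
    ((hasLap_norm_sq y).const_mul κ)).nonpos_of_isLocalMax
      (hmax.isLocalMax (mem_of_superset (hΩo.mem_nhds hyΩ) subset_closure))
  have := hl y hyΩ
  linarith

/-- regularised logarithmic kernel -/
def Lk (D ε : ℝ) (z : E2) : ℝ := 1 / 2 * Real.log (D ^ 2 / (‖z‖ ^ 2 + ε ^ 2))

lemma Lk_continuous {D ε : ℝ} (hD : 0 < D) (hε : 0 < ε) : Continuous (Lk D ε) := by
  unfold Lk
  have h1 : ∀ z : E2, ‖z‖ ^ 2 + ε ^ 2 ≠ 0 := fun z => by positivity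
  have h2 : ∀ z : E2, D ^ 2 / (‖z‖ ^ 2 + ε ^ 2) ≠ 0 := fun z => by positivity
  refine continuous_const.mul (Continuous.log ?_ h2)
  exact continuous_const.div (by fun_prop) h1

lemma Lk_nonneg {D ε : ℝ} (hε : 0 < ε) (hε1 : ε ≤ 1) {z : E2} (hz : ‖z‖ ^ 2 + 1 ≤ D ^ 2) :
    0 ≤ Lk D ε z := by
  unfold Lk
  have : 0 ≤ Real.log (D ^ 2 / (‖z‖ ^ 2 + ε ^ 2)) := by
    apply Real.log_nonneg
    rw [le_div_iff₀ (by positivity)]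
    nlinarith
  positivity

lemma Lk_le {D ε : ℝ} (hD : 0 < D) (hε : 0 < ε) {ρ : ℝ} (hρ : 0 < ρ) {z : E2}
    (hz : ρ ^ 2 ≤ ‖z‖ ^ 2 + ε ^ 2) : Lk D ε z ≤ Real.log (D / ρ) := by
  unfold Lk
  have h1 : Real.log (D ^ 2 / (‖z‖ ^ 2 + ε ^ 2)) ≤ Real.log ((D / ρ) ^ 2) := by
    apply Real.log_le_log (by positivity)
    rw [div_pow]
    gcongr
  rw [Real.log_pow] at h1
  push_cast at h1
  linarith

section pot
variable {Ω : Set E2} {D ε : ℝ} {f : E2 → ℝ}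

lemma Lk_mul_integrableOn (hΩo : IsOpen Ω) (hD0 : 0 < D)
    (hD : ∀ x ∈ closure Ω, ∀ y ∈ closure Ω, ‖x - y‖ ^ 2 + 1 ≤ D ^ 2)
    (hε : 0 < ε) (hε1 : ε ≤ 1) (hf : IntegrableOn f Ω) {x : E2} (hx : x ∈ closure Ω) :
    IntegrableOn (fun y => Lk D ε (x - y) * f y) Ω := by
  refine Integrable.bdd_mul (c := Real.log (D / ε)) hf ?_ ?_
  · exact ((Lk_continuous hD0 hε).comp (by fun_prop)).aestronglyMeasurable
  · refine (ae_restrict_iff' hΩo.measurableSet).2 (Eventually.of_forall fun y hy => ?_)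
    rw [Real.norm_eq_abs, abs_of_nonneg (Lk_nonneg hε hε1 (hD x hx y (subset_closure hy)))]
    exact Lk_le hD0 hε hε (by nlinarith [sq_nonneg ‖x - y‖])

lemma pot_continuousOn (hΩo : IsOpen Ω) (hD0 : 0 < D)
    (hD : ∀ x ∈ closure Ω, ∀ y ∈ closure Ω, ‖x - y‖ ^ 2 + 1 ≤ D ^ 2)
    (hε : 0 < ε) (hε1 : ε ≤ 1) (hf : IntegrableOn f Ω) :
    ContinuousOn (fun x => ∫ y in Ω, Lk D ε (x - y) * f y) (closure Ω) := by
  refine continuousOn_of_dominated (bound := fun y => Real.log (D / ε) * ‖f y‖) ?_ ?_ ?_ ?_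
  · intro x hx
    exact (Lk_mul_integrableOn hΩo hD0 hD hε hε1 hf hx).aestronglyMeasurable
  · intro x hx
    refine (ae_restrict_iff' hΩo.measurableSet).2 (Eventually.of_forall fun y hy => ?_)
    rw [norm_mul]
    gcongr
    rw [Real.norm_eq_abs, abs_of_nonneg (Lk_nonneg hε hε1 (hD x hx y (subset_closure hy)))]
    exact Lk_le hD0 hε hε (by nlinarith [sq_nonneg ‖x - y‖])
  · exact hf.norm.const_mul _
  · refine Eventually.of_forall fun y => Continuous.continuousOn ?_
    exact ((Lk_continuous hD0 hε).comp (by fun_prop)).mul continuous_const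

lemma Lk_line_deriv (hD0 : 0 < D) (hε : 0 < ε) (z : E2) (i : Fin 2) (t : ℝ) :
    HasDerivAt (fun s : ℝ => Lk D ε (z + s • EuclideanSpace.single i (1:ℝ)))
      (-(z i + t) / (‖z + t • (EuclideanSpace.single i (1:ℝ) : E2)‖ ^ 2 + ε ^ 2)) t := by
  have hQ : HasDerivAt (fun s : ℝ => ‖z‖ ^ 2 + 2 * s * z i + s ^ 2 + ε ^ 2) (2 * z i + 2 * t) t := by
    have := (((((hasDerivAt_id t).const_mul 2).mul_const (z i)).const_add (‖z‖^2)).add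
        ((hasDerivAt_id t).pow 2)).add_const (ε ^ 2)
    refine (this.congr_deriv (by simp)).congr_of_eventuallyEq (Eventually.of_forall fun s => ?_)
    simp
  have hpos : ∀ s, 0 < ‖z‖ ^ 2 + 2 * s * z i + s ^ 2 + ε ^ 2 := fun s => by
    rw [← norm_add_single_sq]; positivity
  have h1 := ((hQ.log (hpos t).ne').const_sub (Real.log (D ^ 2))).const_mul (1 / 2 : ℝ)
  rw [norm_add_single_sq]
  refine (h1.congr_deriv ?_).congr_of_eventuallyEq (Eventually.of_forall fun s => ?_)
  · ring
  · simp only [Lk]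
    rw [norm_add_single_sq, Real.log_div (by positivity) (hpos s).ne']

lemma Lk_line_deriv2 (hε : 0 < ε) (z : E2) (i : Fin 2) (t : ℝ) :
    HasDerivAt
      (fun t : ℝ => -(z i + t) / (‖z + t • (EuclideanSpace.single i (1:ℝ) : E2)‖ ^ 2 + ε ^ 2))
      (-1 / (‖z + t • (EuclideanSpace.single i (1:ℝ) : E2)‖ ^ 2 + ε ^ 2)
        + 2 * (z i + t) ^ 2 / (‖z + t • (EuclideanSpace.single i (1:ℝ) : E2)‖ ^ 2 + ε ^ 2) ^ 2) t := by
  have hQ : HasDerivAt (fun s : ℝ => ‖z‖ ^ 2 + 2 * s * z i + s ^ 2 + ε ^ 2) (2 * z i + 2 * t) t := by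
    have := (((((hasDerivAt_id t).const_mul 2).mul_const (z i)).const_add (‖z‖^2)).add
        ((hasDerivAt_id t).pow 2)).add_const (ε ^ 2)
    refine (this.congr_deriv (by simp)).congr_of_eventuallyEq (Eventually.of_forall fun s => ?_)
    simp
  have hpos : ∀ s, 0 < ‖z‖ ^ 2 + 2 * s * z i + s ^ 2 + ε ^ 2 := fun s => by
    rw [← norm_add_single_sq]; positivity
  have hn : HasDerivAt (fun s : ℝ => -(z i + s)) (-1) t :=
    ((hasDerivAt_id t).const_add (z i)).neg
  have h1 := hn.div hQ (hpos t).ne'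
  simp_rw [norm_add_single_sq]
  refine h1.congr_deriv ?_
  have := (hpos t).ne'
  field_simp
  ring

lemma coord_sq_le (z : E2) (i : Fin 2) : z i ^ 2 ≤ ‖z‖ ^ 2 := by
  rw [norm_sq_two]; fin_cases i <;> simp <;> positivity

lemma coord_shift_sq_le (z : E2) (i : Fin 2) (t : ℝ) :
    (z i + t) ^ 2 ≤ ‖z + t • (EuclideanSpace.single i (1:ℝ) : E2)‖ ^ 2 := by
  have := coord_sq_le (z + t • (EuclideanSpace.single i (1:ℝ) : E2)) i
  simpa using this

lemma k1_bound (hε : 0 < ε) (z : E2) (i : Fin 2) (t : ℝ) :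
    ‖-(z i + t) / (‖z + t • (EuclideanSpace.single i (1:ℝ) : E2)‖ ^ 2 + ε ^ 2)‖ ≤ 1 / ε := by
  have h := coord_shift_sq_le z i t
  rw [norm_div, norm_neg, Real.norm_eq_abs, Real.norm_of_nonneg (by positivity),
    div_le_div_iff₀ (by positivity) hε]
  have : (z i + t) ^ 2 = |z i + t| ^ 2 := (sq_abs _).symm
  rw [this] at h
  nlinarith [sq_nonneg (|z i + t| - ε), sq_nonneg (|z i + t|), sq_nonneg ε]

lemma k2_bound (hε : 0 < ε) (z : E2) (i : Fin 2) (t : ℝ) :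
    ‖-1 / (‖z + t • (EuclideanSpace.single i (1:ℝ) : E2)‖ ^ 2 + ε ^ 2)
        + 2 * (z i + t) ^ 2 / (‖z + t • (EuclideanSpace.single i (1:ℝ) : E2)‖ ^ 2 + ε ^ 2) ^ 2‖
      ≤ 3 / ε ^ 2 := by
  have h := coord_shift_sq_le z i t
  set Q := ‖z + t • (EuclideanSpace.single i (1:ℝ) : E2)‖ ^ 2 + ε ^ 2 with hQ
  have hQ0 : ε ^ 2 ≤ Q := by rw [hQ]; nlinarith [sq_nonneg ‖z + t • (EuclideanSpace.single i (1:ℝ) : E2)‖]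
  have hε2 : 0 < ε ^ 2 := by positivity
  have hQp : 0 < Q := by linarith
  have e1 : 1 / Q ≤ 1 / ε ^ 2 := by gcongr
  have e2 : 2 * (z i + t) ^ 2 / Q ^ 2 ≤ 2 * (1 / Q) := by
    rw [div_le_iff₀ (by positivity)]
    have : 2 * (1 / Q) * Q ^ 2 = 2 * Q := by field_simp
    rw [this]; nlinarith
  have e3 : 0 ≤ 2 * (z i + t) ^ 2 / Q ^ 2 := by positivity
  have e4 : 3 / ε ^ 2 = 3 * (1 / ε ^ 2) := by ring
  have e5 : -1 / Q = -(1 / Q) := by ring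
  have e6 : 0 < 1 / Q := by positivity
  rw [Real.norm_eq_abs, abs_le, e4, e5]
  constructor <;> linarith

lemma hasLap_pot (hΩo : IsOpen Ω) (hD0 : 0 < D)
    (hD : ∀ x ∈ closure Ω, ∀ y ∈ closure Ω, ‖x - y‖ ^ 2 + 1 ≤ D ^ 2)
    (hε : 0 < ε) (hε1 : ε ≤ 1) (hf : IntegrableOn f Ω) {x : E2} (hx : x ∈ Ω) :
    HasLap (fun x => ∫ y in Ω, Lk D ε (x - y) * f y) x
      (-∫ y in Ω, 2 * ε ^ 2 / (‖x - y‖ ^ 2 + ε ^ 2) ^ 2 * f y) := by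
  have hne : ∀ z : E2, ‖z‖ ^ 2 + ε ^ 2 ≠ 0 := fun z => by positivity
  have hne2 : ∀ z : E2, (‖z‖ ^ 2 + ε ^ 2) ^ 2 ≠ 0 := fun z => by positivity
  have hsub : ∀ (s : ℝ) (i : Fin 2) (y : E2), x + s • (EuclideanSpace.single i (1:ℝ) : E2) - y
      = (x - y) + s • (EuclideanSpace.single i (1:ℝ) : E2) := fun s i y => by abel
  have hc1 : ∀ (t : ℝ) (i : Fin 2), Continuous (fun y => -((x - y) i + t) /
      (‖(x - y) + t • (EuclideanSpace.single i (1:ℝ) : E2)‖ ^ 2 + ε ^ 2)) := fun t i =>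
    Continuous.div (by fun_prop) (by fun_prop) fun y => hne _
  have hc2 : ∀ (t : ℝ) (i : Fin 2), Continuous (fun y =>
      (-1 / (‖(x - y) + t • (EuclideanSpace.single i (1:ℝ) : E2)‖ ^ 2 + ε ^ 2)
        + 2 * ((x - y) i + t) ^ 2 /
          (‖(x - y) + t • (EuclideanSpace.single i (1:ℝ) : E2)‖ ^ 2 + ε ^ 2) ^ 2)) := fun t i =>
    (Continuous.div (by fun_prop) (by fun_prop) fun y => hne _).add
    (Continuous.div (by fun_prop) (by fun_prop) fun y => hne2 _)
  have hd1 : ∀ (t : ℝ) (i : Fin 2), x + t • (EuclideanSpace.single i (1:ℝ) : E2) ∈ Ω →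
      HasDerivAt (fun s : ℝ => ∫ y in Ω, Lk D ε (x + s • (EuclideanSpace.single i (1:ℝ) : E2) - y) * f y)
        (∫ y in Ω, -((x - y) i + t) /
      (‖(x - y) + t • (EuclideanSpace.single i (1:ℝ) : E2)‖ ^ 2 + ε ^ 2) * f y) t := by
    intro t i ht
    refine (hasDerivAt_integral_of_dominated_loc_of_deriv_le (s := univ)
      (F := fun (s : ℝ) y => Lk D ε (x + s • (EuclideanSpace.single i (1:ℝ) : E2) - y) * f y)
      (F' := fun (t : ℝ) y => -((x - y) i + t) /
      (‖(x - y) + t • (EuclideanSpace.single i (1:ℝ) : E2)‖ ^ 2 + ε ^ 2) * f y)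
      (bound := fun y => 1 / ε * ‖f y‖) univ_mem ?_ ?_ ?_ ?_ ?_ ?_).2
    · refine Eventually.of_forall fun s => AEStronglyMeasurable.mul ?_ hf.aestronglyMeasurable
      exact ((Lk_continuous hD0 hε).comp (by fun_prop)).aestronglyMeasurable
    · exact Lk_mul_integrableOn hΩo hD0 hD hε hε1 hf (subset_closure ht)
    · exact (hc1 t i).aestronglyMeasurable.mul hf.aestronglyMeasurable
    · refine Eventually.of_forall fun y s _ => ?_
      rw [norm_mul]
      gcongr
      exact k1_bound hε _ _ _
    · exact hf.norm.const_mul _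
    · refine Eventually.of_forall fun y s _ => ?_
      simp_rw [hsub]
      exact (Lk_line_deriv hD0 hε (x - y) i s).mul_const _
  have hi2 : ∀ i : Fin 2, Integrable (fun y =>
      (-1 / (‖(x - y) + (0:ℝ) • (EuclideanSpace.single i (1:ℝ) : E2)‖ ^ 2 + ε ^ 2)
        + 2 * ((x - y) i + 0) ^ 2 /
          (‖(x - y) + (0:ℝ) • (EuclideanSpace.single i (1:ℝ) : E2)‖ ^ 2 + ε ^ 2) ^ 2) * f y)
          (volume.restrict Ω) ∧
      HasDerivAt (fun t : ℝ => ∫ y in Ω, -((x - y) i + t) /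
      (‖(x - y) + t • (EuclideanSpace.single i (1:ℝ) : E2)‖ ^ 2 + ε ^ 2) * f y)
      (∫ y in Ω, (-1 / (‖(x - y) + (0:ℝ) • (EuclideanSpace.single i (1:ℝ) : E2)‖ ^ 2 + ε ^ 2)
        + 2 * ((x - y) i + 0) ^ 2 /
          (‖(x - y) + (0:ℝ) • (EuclideanSpace.single i (1:ℝ) : E2)‖ ^ 2 + ε ^ 2) ^ 2) * f y) 0 := by
    intro i
    refine hasDerivAt_integral_of_dominated_loc_of_deriv_le (s := univ)
      (F := fun (t : ℝ) y => -((x - y) i + t) /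
      (‖(x - y) + t • (EuclideanSpace.single i (1:ℝ) : E2)‖ ^ 2 + ε ^ 2) * f y)
      (F' := fun (t : ℝ) y => (-1 / (‖(x - y) + t • (EuclideanSpace.single i (1:ℝ) : E2)‖ ^ 2 + ε ^ 2)
        + 2 * ((x - y) i + t) ^ 2 /
          (‖(x - y) + t • (EuclideanSpace.single i (1:ℝ) : E2)‖ ^ 2 + ε ^ 2) ^ 2) * f y)
      (bound := fun y => 3 / ε ^ 2 * ‖f y‖) univ_mem ?_ ?_ ?_ ?_ ?_ ?_
    · exact Eventually.of_forall fun s =>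
        (hc1 s i).aestronglyMeasurable.mul hf.aestronglyMeasurable
    · exact Integrable.bdd_mul (c := 1 / ε) hf (hc1 0 i).aestronglyMeasurable
        (Eventually.of_forall fun y => k1_bound hε _ _ _)
    · exact (hc2 0 i).aestronglyMeasurable.mul hf.aestronglyMeasurable
    · refine Eventually.of_forall fun y s _ => ?_
      rw [norm_mul]
      gcongr
      exact k2_bound hε _ _ _
    · exact hf.norm.const_mul _
    · refine Eventually.of_forall fun y s _ => ?_
      exact (Lk_line_deriv2 hε (x - y) i s).mul_const _
  refine ⟨_, _, fun i => ?_, fun i => (hi2 i).2, ?_⟩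
  · have hc' : Tendsto (fun s : ℝ => x + s • (EuclideanSpace.single i (1:ℝ) : E2)) (𝓝 0) (𝓝 x) := by
      have hc : ContinuousAt (fun s : ℝ => x + s • (EuclideanSpace.single i (1:ℝ) : E2)) 0 := by
        fun_prop
      have := hc.tendsto
      simpa using this
    filter_upwards [hc'.eventually (hΩo.mem_nhds hx)] with t ht
    exact hd1 t i ht
  · rw [← integral_add (hi2 0).1 (hi2 1).1, ← integral_neg]
    congr 1
    ext y
    have h2 := norm_sq_two (x - y)
    simp only [zero_smul, add_zero]
    have := hne (x - y)
    field_simp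
    rw [h2]
    ring

end pot

lemma integral_eta_ball {ε ρ : ℝ} (hε : 0 < ε) (hρ : 0 < ρ) (x : E2) :
    ∫ y in ball x ρ, 2 * ε ^ 2 / (‖x - y‖ ^ 2 + ε ^ 2) ^ 2 = 2 * π * (ρ ^ 2 / (ρ ^ 2 + ε ^ 2)) := by
  have h0 : ∫ y in ball x ρ, 2 * ε ^ 2 / (‖x - y‖ ^ 2 + ε ^ 2) ^ 2
      = ∫ z : E2, (Iio ρ).indicator (fun r : ℝ => 2 * ε ^ 2 / (r ^ 2 + ε ^ 2) ^ 2) ‖z‖ := by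
    rw [← integral_indicator measurableSet_ball, ← integral_sub_left_eq_self _ volume x]
    congr 1
    ext y
    simp only [indicator, mem_ball, mem_Iio, dist_eq_norm]
    simp [norm_neg]
  rw [h0, integral_fun_norm_addHaar]
  have hfr : Module.finrank ℝ E2 = 2 := by simp
  have hvol : volume.real (ball (0:E2) 1) = π := by
    rw [Measure.real, EuclideanSpace.volume_ball_fin_two]
    simp [Real.pi_pos.le]
  rw [hfr, hvol]
  have h1 : ∫ y in Ioi (0:ℝ), y ^ (2 - 1) • (Iio ρ).indicator
      (fun r : ℝ => 2 * ε ^ 2 / (r ^ 2 + ε ^ 2) ^ 2) y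
      = ∫ y in (0:ℝ)..ρ, y * (2 * ε ^ 2 / (y ^ 2 + ε ^ 2) ^ 2) := by
    rw [intervalIntegral.integral_of_le hρ.le, integral_Ioc_eq_integral_Ioo,
      ← integral_indicator measurableSet_Ioi, ← integral_indicator measurableSet_Ioo]
    congr 1
    ext y
    simp only [indicator, mem_Ioi, mem_Iio, mem_Ioo]
    by_cases ha : 0 < y <;> by_cases hb : y < ρ <;> simp [ha, hb]
  rw [h1]
  have hpos : ∀ y : ℝ, 0 < y ^ 2 + ε ^ 2 := fun y => by positivity
  have h2 : ∫ y in (0:ℝ)..ρ, y * (2 * ε ^ 2 / (y ^ 2 + ε ^ 2) ^ 2)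
      = (-ε ^ 2 / (ρ ^ 2 + ε ^ 2)) - (-ε ^ 2 / (0 ^ 2 + ε ^ 2)) := by
    apply intervalIntegral.integral_eq_sub_of_hasDerivAt
      (f := fun y : ℝ => -ε ^ 2 / (y ^ 2 + ε ^ 2))
    · intro y _
      have hQ : HasDerivAt (fun y : ℝ => y ^ 2 + ε ^ 2) (2 * y) y := by
        have := ((hasDerivAt_id y).pow 2).add_const (ε ^ 2)
        refine (this.congr_deriv (by simp)).congr_of_eventuallyEq (Eventually.of_forall fun s => ?_)
        simp
      have := (hasDerivAt_const y (-ε ^ 2)).div hQ (hpos y).ne'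
      refine this.congr_deriv ?_
      have := (hpos y).ne'
      field_simp
      ring
    · apply Continuous.intervalIntegrable
      exact continuous_id.mul (continuous_const.div (by fun_prop) fun y => by positivity)
  rw [h2]
  simp only [nsmul_eq_mul, smul_eq_mul]
  field_simp
  push_cast
  ring

lemma approx_identity {Ω K : Set E2} (hΩo : IsOpen Ω) {f : E2 → ℝ} (hfc : ContinuousOn f Ω)
    (hfi : IntegrableOn f Ω) (hf0 : ∀ x ∈ Ω, 0 ≤ f x) (hK : IsCompact K) (hKΩ : K ⊆ Ω)
    {τ : ℝ} (hτ : 0 < τ) : ∃ ε > 0, ε ≤ 1 ∧ ∀ x ∈ K,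
      f x - τ ≤ 1 / (2 * π) * ∫ y in Ω, 2 * ε ^ 2 / (‖x - y‖ ^ 2 + ε ^ 2) ^ 2 * f y := by
  obtain ⟨δ, hδ, hδΩ⟩ := hK.exists_cthickening_subset_open hΩo hKΩ
  have hK' : IsCompact (cthickening δ K) := hK.cthickening
  have huc := hK'.uniformContinuousOn_of_continuous (hfc.mono hδΩ)
  obtain ⟨r, hr, hrf⟩ := Metric.uniformContinuousOn_iff.1 huc (τ / 2) (by positivity)
  obtain ⟨F, hF⟩ := hK.exists_bound_of_continuousOn (hfc.mono hKΩ)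
  set ρ := min δ r with hρdef
  have hρ : 0 < ρ := lt_min hδ hr
  set F' := max F 0 + 1
  have hF' : 0 < F' := by positivity
  obtain ⟨ε, hε, hε1⟩ : ∃ ε > 0, ε ≤ 1 ∧ ε ≤ τ * ρ ^ 2 / (2 * F') :=
    ⟨min 1 (τ * ρ ^ 2 / (2 * F')), by positivity, min_le_left _ _, min_le_right _ _⟩
  refine ⟨ε, hε, hε1.1, fun x hx => ?_⟩
  have hball : ball x ρ ⊆ cthickening δ K := by
    intro y hy
    apply thickening_subset_cthickening
    rw [mem_thickening_iff]
    exact ⟨x, hx, lt_of_lt_of_le (mem_ball.1 hy) (min_le_left _ _)⟩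
  have hcη : Continuous fun y => 2 * ε ^ 2 / (‖x - y‖ ^ 2 + ε ^ 2) ^ 2 :=
    continuous_const.div (by fun_prop) fun y => by positivity
  have hηb : ∀ y, ‖2 * ε ^ 2 / (‖x - y‖ ^ 2 + ε ^ 2) ^ 2‖ ≤ 2 / ε ^ 2 := by
    intro y
    rw [Real.norm_of_nonneg (by positivity), div_le_div_iff₀ (by positivity) (by positivity)]
    nlinarith [sq_nonneg ‖x - y‖, sq_nonneg ε, mul_nonneg (sq_nonneg ‖x - y‖) (sq_nonneg ε),
      sq_nonneg (‖x-y‖^2)]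
  have hint : IntegrableOn (fun y => 2 * ε ^ 2 / (‖x - y‖ ^ 2 + ε ^ 2) ^ 2 * f y) Ω :=
    Integrable.bdd_mul (c := 2 / ε ^ 2) hfi hcη.aestronglyMeasurable (Eventually.of_forall hηb)
  have s1 : ∫ y in ball x ρ, 2 * ε ^ 2 / (‖x - y‖ ^ 2 + ε ^ 2) ^ 2 * f y
      ≤ ∫ y in Ω, 2 * ε ^ 2 / (‖x - y‖ ^ 2 + ε ^ 2) ^ 2 * f y := by
    apply setIntegral_mono_set hint
    · refine (ae_restrict_iff' hΩo.measurableSet).2 (Eventually.of_forall fun y hy => ?_)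
      have := hf0 y hy
      simp only [Pi.zero_apply]
      positivity
    · exact (hball.trans hδΩ).eventuallyLE
  have s2 : ∫ y in ball x ρ, 2 * ε ^ 2 / (‖x - y‖ ^ 2 + ε ^ 2) ^ 2 * (f x - τ / 2)
      ≤ ∫ y in ball x ρ, 2 * ε ^ 2 / (‖x - y‖ ^ 2 + ε ^ 2) ^ 2 * f y := by
    apply setIntegral_mono_on _ (hint.mono_set (hball.trans hδΩ)) measurableSet_ball
    · intro y hy
      have h1 := hrf x (self_subset_cthickening K hx) y (hball hy) (by
        rw [dist_comm]; exact lt_of_lt_of_le (mem_ball.1 hy) (min_le_right _ _))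
      rw [Real.dist_eq, abs_lt] at h1
      gcongr
      linarith [h1.2]
    · exact ((hcη.mul continuous_const).continuousOn.integrableOn_compact
        (isCompact_closedBall x ρ)).mono_set ball_subset_closedBall
  rw [integral_mul_const, integral_eta_ball hε hρ] at s2
  have hfx : f x ≤ F' := by
    have := hF x hx
    rw [Real.norm_eq_abs] at this
    have h2 := le_abs_self (f x)
    have h3 : F ≤ max F 0 := le_max_left _ _
    simp only [F']
    linarith
  have hfx0 := hf0 x (hKΩ hx)
  set θ := ρ ^ 2 / (ρ ^ 2 + ε ^ 2) with hθ
  have hθ1 : 1 - θ = ε ^ 2 / (ρ ^ 2 + ε ^ 2) := by rw [hθ]; field_simp; ring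
  have hθ0 : 0 ≤ 1 - θ := by rw [hθ1]; positivity
  have h5 : f x * (1 - θ) ≤ τ / 2 := by
    have : 1 - θ ≤ ε ^ 2 / ρ ^ 2 := by
      rw [hθ1]; gcongr; nlinarith
    have h6 : ε ^ 2 ≤ τ * ρ ^ 2 / (2 * F') := by nlinarith [hε1.1, hε1.2]
    have h7 : ε ^ 2 / ρ ^ 2 ≤ τ / (2 * F') := by
      rw [div_le_iff₀ (by positivity)]
      calc ε ^ 2 ≤ _ := h6
        _ = _ := by ring
    calc f x * (1 - θ) ≤ F' * (τ / (2 * F')) := by gcongr; linarith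
      _ = τ / 2 := by field_simp
  have h8 : (f x - τ / 2) * θ = 1 / (2 * π) * (2 * π * θ * (f x - τ / 2)) := by
    field_simp
  calc f x - τ ≤ (f x - τ / 2) * θ := by nlinarith
    _ = 1 / (2 * π) * (2 * π * θ * (f x - τ / 2)) := h8
    _ ≤ _ := by gcongr; exact s2.trans s1

lemma potential_bound {Ω : Set E2} (hΩo : IsOpen Ω) (hΩb : Bornology.IsBounded Ω) {D : ℝ}
    (hD0 : 0 < D) (hD : ∀ x ∈ closure Ω, ∀ y ∈ closure Ω, ‖x - y‖ ^ 2 + 1 ≤ D ^ 2)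
    {u f : E2 → ℝ} (hu : ContDiffOn ℝ 2 u (closure Ω)) (hl : ∀ x ∈ Ω, -lap u x = f x)
    (hf0 : ∀ x ∈ Ω, 0 ≤ f x) (hfc : ContinuousOn f Ω) (hfi : IntegrableOn f Ω)
    (hb : ∀ x ∈ frontier Ω, u x = 0) :
    ∃ ε > 0, ε ≤ 1 ∧ ∀ x ∈ Ω, u x ≤ 1 + 1 / (2 * π) * ∫ y in Ω, Lk D ε (x - y) * f y := by
  have hKc : IsCompact (closure Ω) := hΩb.isCompact_closure
  obtain ⟨B, hB⟩ := hΩb.closure.exists_norm_le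
  set κ : ℝ := 1 / (2 * (B ^ 2 + 1)) with hκ
  have hκ0 : 0 < κ := by positivity
  have hκB : κ * (B ^ 2 + 1) = 1 / 2 := by rw [hκ]; field_simp
  set K : Set E2 := {y ∈ closure Ω | 1 / 2 ≤ u y} with hKdef
  have hK : IsCompact K := by
    have : IsClosed K := by
      have := hu.continuousOn.preimage_isClosed_of_isClosed isClosed_closure
        (isClosed_Ici (a := (1 / 2 : ℝ)))
      exact this
    exact hKc.of_isClosed_subset this fun y hy => hy.1
  have hKΩ : K ⊆ Ω := by
    intro y hy
    by_contra hyn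
    have hyf : y ∈ frontier Ω := by rw [hΩo.frontier_eq]; exact ⟨hy.1, hyn⟩
    have := hy.2
    rw [hb y hyf] at this
    norm_num at this
  obtain ⟨ε, hε, hε1, happ⟩ := approx_identity hΩo hfc hfi hf0 hK hKΩ (τ := κ) hκ0
  refine ⟨ε, hε, hε1, fun x hx => ?_⟩
  by_contra hcon
  push Not at hcon
  set N : E2 → ℝ := fun x => ∫ y in Ω, Lk D ε (x - y) * f y with hN
  have hN0 : ∀ y ∈ closure Ω, 0 ≤ N y := by
    intro y hy
    apply setIntegral_nonneg hΩo.measurableSet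
    intro z hz
    exact mul_nonneg (Lk_nonneg hε hε1 (hD y hy z (subset_closure hz))) (hf0 z hz)
  have hcont : ContinuousOn (fun y => u y + -(1 / (2 * π)) * N y + κ * ‖y‖ ^ 2) (closure Ω) := by
    have h1 := hu.continuousOn
    have h2 : ContinuousOn N (closure Ω) := pot_continuousOn hΩo hD0 hD hε hε1 hfi
    fun_prop
  obtain ⟨y, hy, hmax⟩ := hKc.exists_isMaxOn ⟨x, subset_closure hx⟩ hcont
  have h1 : u x + -(1 / (2 * π)) * N x + κ * ‖x‖ ^ 2 ≤ u y + -(1 / (2 * π)) * N y + κ * ‖y‖ ^ 2 :=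
    hmax (subset_closure hx)
  have hcon' : 1 + 1 / (2 * π) * N x < u x := hcon
  have hyK : y ∈ K := by
    refine ⟨hy, ?_⟩
    have h2 : ‖y‖ ^ 2 ≤ B ^ 2 := by
      have := hB y hy
      gcongr
    have h3 : 0 ≤ 1 / (2 * π) * N y := mul_nonneg (by positivity) (hN0 y hy)
    have h4 : 0 ≤ κ * ‖x‖ ^ 2 := by positivity
    have h5 : κ * ‖y‖ ^ 2 ≤ 1 / 2 := by
      rw [← hκB]; gcongr; linarith
    linarith
  have hyΩ := hKΩ hyK
  have hlap := (((hasLap_lap hΩo (hu.mono subset_closure) hyΩ).add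
    ((hasLap_pot hΩo hD0 hD hε hε1 hfi hyΩ).const_mul (-(1 / (2 * π))))).add
    ((hasLap_norm_sq y).const_mul κ)).nonpos_of_isLocalMax
      (hmax.isLocalMax (mem_of_superset (hΩo.mem_nhds hyΩ) subset_closure))
  have h6 := hl y hyΩ
  have h7 := happ y hyK
  linarith

lemma exp_Lk_integral_bound {D s : ℝ} (hD0 : 0 < D) (hs0 : 0 ≤ s) (hs : s < 2) :
    ∃ C, 0 ≤ C ∧ ∀ ε > 0, ∀ A : Set E2, MeasurableSet A → ∀ x, (∀ y ∈ A, ‖x - y‖ ≤ D) →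
      ∫ y in A, Real.exp (s * Lk D ε (x - y)) ≤ C := by
  have hloc : LocallyIntegrable (fun z : E2 => D ^ s * ‖z‖ ^ (-s)) volume := by
    refine locallyIntegrable_of_norm_le_rpow (C := D ^ s) (α := s) ?_ ?_ ?_ ?_
    · simp
    · simpa using hs
    · refine Eventually.of_forall fun z => ?_
      rw [Real.norm_of_nonneg (by positivity)]
    · apply Measurable.aestronglyMeasurable
      fun_prop
  have hint : IntegrableOn (fun z : E2 => D ^ s * ‖z‖ ^ (-s)) (closedBall 0 D) :=
    hloc.integrableOn_isCompact (isCompact_closedBall 0 D)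
  refine ⟨∫ z in closedBall (0:E2) D, D ^ s * ‖z‖ ^ (-s), ?_, ?_⟩
  · apply setIntegral_nonneg measurableSet_closedBall
    intro z _; positivity
  intro ε hε A hA x hxA
  have hc : Continuous fun y : E2 => Real.exp (s * Lk D ε y) := by
    have := Lk_continuous hD0 hε
    fun_prop
  have hcx : Continuous fun y : E2 => Real.exp (s * Lk D ε (x - y)) := hc.comp (by fun_prop)
  calc ∫ y in A, Real.exp (s * Lk D ε (x - y))
      ≤ ∫ y in closedBall x D, Real.exp (s * Lk D ε (x - y)) := by
        apply setIntegral_mono_set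
        · exact hcx.continuousOn.integrableOn_compact (isCompact_closedBall x D)
        · exact Eventually.of_forall fun y => (Real.exp_pos _).le
        · apply Eventually.of_forall
          intro y hy
          change y ∈ closedBall x D
          rw [mem_closedBall, dist_comm, dist_eq_norm]
          exact hxA y hy
    _ = ∫ z in closedBall (0:E2) D, Real.exp (s * Lk D ε z) := by
        rw [← integral_indicator measurableSet_closedBall,
          ← integral_indicator measurableSet_closedBall, ← integral_sub_left_eq_self _ volume x]
        congr 1
        ext y
        simp only [indicator, mem_closedBall, dist_eq_norm]
        simp [norm_neg]
    _ ≤ _ := by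
        apply setIntegral_mono_ae (hc.continuousOn.integrableOn_compact (isCompact_closedBall 0 D))
          hint
        have : ∀ᵐ z : E2, z ≠ 0 := by simp [ae_iff]
        filter_upwards [this] with z hz
        have hz0 : 0 < ‖z‖ := norm_pos_iff.2 hz
        have h1 : Lk D ε z ≤ Real.log (D / ‖z‖) := Lk_le hD0 hε hz0 (by nlinarith)
        calc Real.exp (s * Lk D ε z) ≤ Real.exp (s * Real.log (D / ‖z‖)) := by gcongr
          _ = (D / ‖z‖) ^ s := by rw [Real.rpow_def_of_pos (by positivity), mul_comm]
          _ = D ^ s * ‖z‖ ^ (-s) := by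
            rw [Real.div_rpow hD0.le hz0.le, Real.rpow_neg hz0.le]; rfl

lemma pot_split {Ω : Set E2} (hΩo : IsOpen Ω) {D ε : ℝ} (hD0 : 0 < D)
    (hD : ∀ x ∈ closure Ω, ∀ y ∈ closure Ω, ‖x - y‖ ^ 2 + 1 ≤ D ^ 2) (hε : 0 < ε) (hε1 : ε ≤ 1)
    {g : E2 → ℝ} (hg0 : ∀ x ∈ Ω, 0 ≤ g x) (hgi : IntegrableOn g Ω) {M : ℝ}
    (hM : ∫ y in Ω, g y ≤ M) {R : ℝ} (hR : 0 < R) (hRD : R ≤ D) (x₀ : E2) {x : E2}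
    (hx : x ∈ ball x₀ R ∩ Ω) :
    ∫ y in Ω, Lk D ε (x - y) * g y ≤
      (∫ y in ball x₀ (2 * R) ∩ Ω, Lk D ε (x - y) * g y) + Real.log (D / R) * M := by
  have hi := Lk_mul_integrableOn hΩo hD0 hD hε hε1 hgi (subset_closure hx.2)
  rw [← integral_inter_add_sdiff (s := Ω) (t := ball x₀ (2 * R)) measurableSet_ball hi,
    inter_comm Ω]
  gcongr
  have hl0 : 0 ≤ Real.log (D / R) := Real.log_nonneg (by rwa [one_le_div hR])
  calc ∫ y in Ω \ ball x₀ (2 * R), Lk D ε (x - y) * g y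
      ≤ ∫ y in Ω \ ball x₀ (2 * R), Real.log (D / R) * g y := by
        apply setIntegral_mono_on (hi.mono_set sdiff_subset)
          ((hgi.mono_set sdiff_subset).const_mul _) (hΩo.measurableSet.diff measurableSet_ball)
        intro y hy
        apply mul_le_mul_of_nonneg_right _ (hg0 y hy.1)
        apply Lk_le hD0 hε hR
        have h1 : 2 * R ≤ dist y x₀ := by
          have := hy.2; rw [mem_ball] at this; linarith
        have h2 : dist x x₀ < R := hx.1
        have h3 : R ≤ ‖x - y‖ := by
          rw [← dist_eq_norm]
          have := dist_triangle y x x₀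
          rw [dist_comm y x] at this
          linarith
        nlinarith [sq_nonneg ε]
    _ = Real.log (D / R) * ∫ y in Ω \ ball x₀ (2 * R), g y := integral_const_mul _ _
    _ ≤ Real.log (D / R) * M := by
        gcongr
        refine le_trans ?_ hM
        apply setIntegral_mono_set hgi
        · exact (ae_restrict_iff' hΩo.measurableSet).2 (Eventually.of_forall hg0)
        · exact sdiff_subset.eventuallyLE

lemma norm_le_of_sq {D r : ℝ} (hD0 : 0 < D) (h : r ^ 2 + 1 ≤ D ^ 2) : r ≤ D := by
  nlinarith

lemma step_bound {Ω : Set E2} (hΩo : IsOpen Ω) {D : ℝ} (hD0 : 0 < D)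
    (hD : ∀ x ∈ closure Ω, ∀ y ∈ closure Ω, ‖x - y‖ ^ 2 + 1 ≤ D ^ 2) (x₀ : E2)
    {R : ℝ} (hR : 0 < R) (hRD : R ≤ D) {b p : ℝ} (P M : ℝ) (hb : 0 ≤ b) (hp : 1 < p) :
    ∃ C, ∀ ε > 0, ε ≤ 1 → ∀ u v g : E2 → ℝ, (∀ x ∈ Ω, 0 ≤ g x) → IntegrableOn g Ω →
      ∫ y in Ω, g y ≤ M → (∀ x ∈ ball x₀ (2 * R) ∩ Ω, g x ≤ b * Real.exp (u x)) →
      IntegrableOn (fun x => Real.exp (p * u x)) (ball x₀ (2 * R) ∩ Ω) →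
      ∫ x in ball x₀ (2 * R) ∩ Ω, Real.exp (p * u x) ≤ P →
      (∀ x ∈ Ω, v x ≤ 1 + 1 / (2 * π) * ∫ y in Ω, Lk D ε (x - y) * g y) →
      ∀ x ∈ ball x₀ R ∩ Ω, v x ≤ C := by
  obtain ⟨C, hC0, hC⟩ := exp_Lk_integral_bound (s := 1) hD0 (by norm_num) (by norm_num)
  set q : ℝ := 1 / (1 - 1 / p) with hq
  have hp1 : 1 / p < 1 := by rw [div_lt_one (by linarith)]; exact hp
  have hp0 : 0 < 1 / p := by positivity
  have hq0 : 0 < q := by rw [hq]; apply div_pos one_pos; linarith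
  refine ⟨1 + 1 / (2 * π) * ((b * q) * (C + P) + Real.log (D / R) * M), ?_⟩
  intro ε hε hε1 u v g hg0 hgi hM hgu hui hP hv x hx
  refine (hv x hx.2).trans ?_
  gcongr
  refine (pot_split hΩo hD0 hD hε hε1 hg0 hgi hM hR hRD x₀ hx).trans ?_
  gcongr
  set A := ball x₀ (2 * R) ∩ Ω
  have hA : MeasurableSet A := measurableSet_ball.inter hΩo.measurableSet
  have hAi : IntegrableOn (fun y => Real.exp (1 * Lk D ε (x - y))) A := by
    have hc : Continuous fun y : E2 => Real.exp (1 * Lk D ε (x - y)) := by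
      have := (Lk_continuous hD0 hε).comp (continuous_const.sub continuous_id : Continuous fun y : E2 => x - y)
      exact Real.continuous_exp.comp (continuous_const.mul this)
    exact (hc.continuousOn.integrableOn_compact (isCompact_closedBall x₀ (2 * R))).mono_set
      (inter_subset_left.trans ball_subset_closedBall)
  calc ∫ y in A, Lk D ε (x - y) * g y
      ≤ ∫ y in A, (b * q) * (Real.exp (1 * Lk D ε (x - y)) + Real.exp (p * u y)) := by
        apply setIntegral_mono_on _ ((hAi.add hui).const_mul _) hA
        · intro y hy
          have hL0 : 0 ≤ Lk D ε (x - y) :=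
            Lk_nonneg hε hε1 (hD x (subset_closure hx.2) y (subset_closure hy.2))
          set L := Lk D ε (x - y)
          have h1 : L ≤ q * Real.exp ((1 - 1 / p) * L) := by
            have h2 := Real.add_one_le_exp ((1 - 1 / p) * L)
            have h3 : L = q * ((1 - 1 / p) * L) := by
              have h0 : 1 - 1 / p ≠ 0 := by linarith
              rw [hq, ← mul_assoc, one_div_mul_cancel h0, one_mul]
            calc L = q * ((1 - 1 / p) * L) := h3
              _ ≤ _ := by gcongr; linarith
          have h4 : Real.exp ((1 - 1 / p) * L) * Real.exp (u y) ≤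
              Real.exp (1 * L) + Real.exp (p * u y) := by
            rw [← Real.exp_add]
            have h5 : u y = 1 / p * (p * u y) := by field_simp
            rcases le_total L (p * u y) with h | h
            · have : Real.exp ((1 - 1 / p) * L + u y) ≤ Real.exp (p * u y) := by
                apply Real.exp_le_exp.2; nlinarith
              linarith [Real.exp_pos (1 * L)]
            · have : Real.exp ((1 - 1 / p) * L + u y) ≤ Real.exp (1 * L) := by
                apply Real.exp_le_exp.2; nlinarith
              linarith [Real.exp_pos (p * u y)]
          calc L * g y ≤ L * (b * Real.exp (u y)) := by gcongr; exact hgu y hy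
            _ ≤ (q * Real.exp ((1 - 1 / p) * L)) * (b * Real.exp (u y)) := by gcongr
            _ = (b * q) * (Real.exp ((1 - 1 / p) * L) * Real.exp (u y)) := by ring
            _ ≤ (b * q) * (Real.exp (1 * L) + Real.exp (p * u y)) := by gcongr
        · exact (Lk_mul_integrableOn hΩo hD0 hD hε hε1 hgi (subset_closure hx.2)).mono_set
            inter_subset_right
    _ = (b * q) * ((∫ y in A, Real.exp (1 * Lk D ε (x - y))) + ∫ y in A, Real.exp (p * u y)) := by
        rw [integral_const_mul, integral_add hAi hui]
    _ ≤ _ := by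
        gcongr
        exact hC ε hε A hA x fun y hy =>
          norm_le_of_sq hD0 (hD x (subset_closure hx.2) y (subset_closure hy.2))

lemma exp_step {Ω : Set E2} (hΩo : IsOpen Ω) {D : ℝ} (hD0 : 0 < D)
    (hD : ∀ x ∈ closure Ω, ∀ y ∈ closure Ω, ‖x - y‖ ^ 2 + 1 ≤ D ^ 2) (x₀ : E2)
    {R : ℝ} (hR : 0 < R) (hRD : R ≤ D) {m : ℝ} (M : ℝ) (hm : 0 < m) (hm4 : m < 4 * π) :
    ∃ p P, 1 < p ∧ ∀ ε > 0, ε ≤ 1 → ∀ u f : E2 → ℝ, (∀ x ∈ Ω, 0 ≤ f x) → IntegrableOn f Ω →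
      ∫ y in Ω, f y ≤ M → ∫ y in ball x₀ (2 * R) ∩ Ω, f y ≤ m →
      IntegrableOn (fun x => Real.exp (p * u x)) (ball x₀ R ∩ Ω) →
      (∀ x ∈ Ω, u x ≤ 1 + 1 / (2 * π) * ∫ y in Ω, Lk D ε (x - y) * f y) →
      ∫ x in ball x₀ R ∩ Ω, Real.exp (p * u x) ≤ P := by
  have hπ := Real.pi_pos
  obtain ⟨p, hp1, hps⟩ : ∃ p : ℝ, 1 < p ∧ p * m / (2 * π) < 2 := by
    have h1 : 1 < 4 * π / m := by rw [one_lt_div hm]; exact hm4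
    obtain ⟨p, h2, h3⟩ := exists_between h1
    refine ⟨p, h2, ?_⟩
    rw [lt_div_iff₀ hm] at h3
    rw [div_lt_iff₀ (by positivity)]
    linarith
  set s := p * m / (2 * π) with hs
  have hs0 : 0 ≤ s := by positivity
  obtain ⟨C, hC0, hC⟩ := exp_Lk_integral_bound (s := s) hD0 hs0 hps
  set c0 : ℝ := 1 + 1 / (2 * π) * (Real.log (D / R) * M) with hc0
  refine ⟨p, Real.exp (p * c0) * (Real.exp 1 * volume.real (ball x₀ R) + C), hp1, ?_⟩
  intro ε hε hε1 u f hf0 hfi hM hfm hui hu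
  set A := ball x₀ (2 * R) ∩ Ω with hAdef
  set A' := ball x₀ R ∩ Ω with hA'def
  have hA : MeasurableSet A := measurableSet_ball.inter hΩo.measurableSet
  have hA' : MeasurableSet A' := measurableSet_ball.inter hΩo.measurableSet
  have hfA : IntegrableOn f A := hfi.mono_set inter_subset_right
  have hAfin : volume A' < ⊤ := lt_of_le_of_lt (measure_mono inter_subset_left) measure_ball_lt_top
  have hcE : Continuous fun z : E2 => Real.exp (s * Lk D ε z) := by
    have := Lk_continuous hD0 hε
    fun_prop
  have hEb : ∀ z : E2, ‖Real.exp (s * Lk D ε z)‖ ≤ Real.exp (s * Real.log (D / ε)) := fun z => by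
    rw [Real.norm_of_nonneg (Real.exp_pos _).le]
    gcongr
    exact Lk_le hD0 hε hε (by nlinarith [sq_nonneg ‖z‖])
  have hEi : ∀ x, IntegrableOn (fun y => Real.exp (s * Lk D ε (x - y)) * f y) A := fun x =>
    Integrable.bdd_mul hfA (hcE.comp (by fun_prop : Continuous fun y : E2 => x - y)).aestronglyMeasurable
      (Eventually.of_forall fun y => hEb _)
  -- pointwise bound
  have hpt : ∀ x ∈ A', Real.exp (p * u x) ≤ Real.exp (p * c0) *
      (Real.exp 1 + 1 / m * ∫ y in A, Real.exp (s * Lk D ε (x - y)) * f y) := by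
    intro x hx
    set J := ∫ y in A, Lk D ε (x - y) * f y with hJ
    set I := ∫ y in A, Real.exp (s * Lk D ε (x - y)) * f y with hI
    set a := p / (2 * π) * J with ha
    have hLi : IntegrableOn (fun y => Lk D ε (x - y) * f y) A :=
      (Lk_mul_integrableOn hΩo hD0 hD hε hε1 hfi (subset_closure hx.2)).mono_set inter_subset_right
    have h1 : p * u x ≤ p * c0 + a := by
      have h2 := hu x hx.2
      have h3 := pot_split hΩo hD0 hD hε hε1 hf0 hfi hM hR hRD x₀ hx
      have h4 : u x ≤ c0 + 1 / (2 * π) * J := by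
        have : 1 / (2 * π) * ∫ y in Ω, Lk D ε (x - y) * f y ≤
          1 / (2 * π) * (J + Real.log (D / R) * M) := by gcongr
        rw [hc0]; linarith
      calc p * u x ≤ p * (c0 + 1 / (2 * π) * J) := by gcongr
        _ = p * c0 + a := by rw [ha]; ring
    have hI0 : 0 ≤ I := setIntegral_nonneg hA fun y hy =>
      mul_nonneg (Real.exp_pos _).le (hf0 y hy.2)
    have h5 : Real.exp a ≤ Real.exp 1 + 1 / m * I := by
      rcases le_total a 1 with h | h
      · have : 0 ≤ 1 / m * I := by positivity
        linarith [Real.exp_le_exp.2 h]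
      · have h6 : ∫ y in A, Real.exp a * ((1 - a) * f y + s * (Lk D ε (x - y) * f y)) ≤ I := by
          apply setIntegral_mono_on _ (hEi x) hA
          · intro y hy
            have h7 := Real.add_one_le_exp (s * Lk D ε (x - y) - a)
            have h8 : Real.exp (s * Lk D ε (x - y)) =
                Real.exp a * Real.exp (s * Lk D ε (x - y) - a) := by
              rw [← Real.exp_add]; congr 1; ring
            rw [h8]
            have h9 := hf0 y hy.2
            calc Real.exp a * ((1 - a) * f y + s * (Lk D ε (x - y) * f y))
                = Real.exp a * (s * Lk D ε (x - y) - a + 1) * f y := by ring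
              _ ≤ _ := by gcongr
          · exact ((hfA.const_mul _).add (hLi.const_mul _)).const_mul _
        rw [integral_const_mul, integral_add (hfA.const_mul _) (hLi.const_mul _),
          integral_const_mul, integral_const_mul] at h6
        have h7 : s * J = m * a := by rw [hs, ha]; ring
        rw [← hJ, h7] at h6
        have h8 : m ≤ (1 - a) * (∫ y in A, f y) + m * a := by nlinarith
        have h9 : Real.exp a * m ≤ I := le_trans (by gcongr) h6
        have h10 : Real.exp a ≤ 1 / m * I := by
          rw [one_div, ← div_eq_inv_mul, le_div_iff₀ hm]; exact h9
        linarith [Real.exp_pos 1]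
    calc Real.exp (p * u x) ≤ Real.exp (p * c0 + a) := Real.exp_le_exp.2 h1
      _ = Real.exp (p * c0) * Real.exp a := Real.exp_add _ _
      _ ≤ _ := by gcongr
  have : IsFiniteMeasure (volume.restrict A') := ⟨by simpa using hAfin⟩
  have hprod : Integrable (Function.uncurry fun x y => Real.exp (s * Lk D ε (x - y)) * f y)
      ((volume.restrict A').prod (volume.restrict A)) := by
    refine Integrable.bdd_mul (c := Real.exp (s * Real.log (D / ε)))
      (g := fun z : E2 × E2 => f z.2) (f := fun z : E2 × E2 => Real.exp (s * Lk D ε (z.1 - z.2)))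
      ?_ ?_ (Eventually.of_forall fun z => hEb _)
    · exact Integrable.comp_snd hfA _
    · exact (hcE.comp (by fun_prop : Continuous fun z : E2 × E2 => z.1 - z.2)).aestronglyMeasurable
  have hIi : IntegrableOn (fun x => ∫ y in A, Real.exp (s * Lk D ε (x - y)) * f y) A' :=
    hprod.integral_prod_left
  have hdouble : ∫ x in A', ∫ y in A, Real.exp (s * Lk D ε (x - y)) * f y ≤ C * m := by
    rw [integral_integral_swap hprod]
    calc ∫ y in A, ∫ x in A', Real.exp (s * Lk D ε (x - y)) * f y
        ≤ ∫ y in A, C * f y := by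
          apply setIntegral_mono_on _ (hfA.const_mul _) hA
          · intro y hy
            rw [integral_mul_const]
            apply mul_le_mul_of_nonneg_right _ (hf0 y hy.2)
            have h1 := hC ε hε A' hA' y fun x hx =>
              norm_le_of_sq hD0 (hD y (subset_closure hy.2) x (subset_closure hx.2))
            refine le_trans (le_of_eq ?_) h1
            congr 1
            ext x
            simp only [Lk, norm_sub_rev x y]
          · exact hprod.integral_prod_right
      _ = C * ∫ y in A, f y := integral_const_mul _ _
      _ ≤ C * m := by gcongr
  have hci : IntegrableOn (fun _ : E2 => Real.exp 1) A' := integrableOn_const hAfin.ne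
  calc ∫ x in A', Real.exp (p * u x)
      ≤ ∫ x in A', Real.exp (p * c0) *
      (Real.exp 1 + 1 / m * ∫ y in A, Real.exp (s * Lk D ε (x - y)) * f y) :=
        setIntegral_mono_on hui ((hci.add (hIi.const_mul _)).const_mul _) hA' hpt
    _ = Real.exp (p * c0) * (volume.real A' * Real.exp 1 +
        1 / m * ∫ x in A', ∫ y in A, Real.exp (s * Lk D ε (x - y)) * f y) := by
        rw [integral_const_mul, integral_add hci (hIi.const_mul _), integral_const_mul,
          setIntegral_const, smul_eq_mul]
    _ ≤ _ := by
        have h1 : volume.real A' ≤ volume.real (ball x₀ R) :=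
          measureReal_mono inter_subset_left measure_ball_lt_top.ne
        have h2 : 1 / m * ∫ x in A', ∫ y in A, Real.exp (s * Lk D ε (x - y)) * f y ≤ C := by
          rw [one_div, ← div_eq_inv_mul, div_le_iff₀ hm]; exact hdouble
        rw [mul_comm (Real.exp 1)]
        gcongr

/-- The case in which the first limiting measure has small mass at `x₀`. -/
lemma boundary_core (Ω : Set E2) (hΩo : IsOpen Ω)
    (hΩb : Bornology.IsBounded Ω)
    (b₁ b₂ C₁ C₂ : ℝ) (V W u v : ℕ → E2 → ℝ)
    (hureg : ∀ i, ContDiffOn ℝ 2 (u i) (closure Ω))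
    (hvreg : ∀ i, ContDiffOn ℝ 2 (v i) (closure Ω))
    (hequ : ∀ i, ∀ x ∈ Ω, -lap (u i) x = V i x * Real.exp (v i x))
    (heqv : ∀ i, ∀ x ∈ Ω, -lap (v i) x = W i x * Real.exp (u i x))
    (hubd : ∀ i, ∀ x ∈ frontier Ω, u i x = 0)
    (hvbd : ∀ i, ∀ x ∈ frontier Ω, v i x = 0)
    (hV : ∀ i, ∀ x ∈ Ω, 0 ≤ V i x ∧ V i x ≤ b₁)
    (hW : ∀ i, ∀ x ∈ Ω, 0 ≤ W i x ∧ W i x ≤ b₂)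
    (hIu : ∀ i, (∫ x in Ω, Real.exp (u i x)) ≤ C₁)
    (hIv : ∀ i, (∫ x in Ω, Real.exp (v i x)) ≤ C₂)
    (μ₁ : Measure E2) [IsFiniteMeasure μ₁]
    (hconv₁ : ∀ φ : E2 → ℝ, ContinuousOn φ (closure Ω) →
      Tendsto (fun i => ∫ x in Ω, V i x * Real.exp (v i x) * φ x) atTop
        (𝓝 (∫ x in closure Ω, φ x ∂μ₁)))
    (x₀ : E2) (hx₀ : x₀ ∈ frontier Ω)
    (hmass : μ₁ {x₀} < ENNReal.ofReal (4 * π)) :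
    ∃ R > (0 : ℝ), ∃ C : ℝ, ∀ i, ∀ x ∈ Metric.ball x₀ R ∩ closure Ω,
      |u i x| ≤ C ∧ |v i x| ≤ C := by
  have hKc : IsCompact (closure Ω) := hΩb.isCompact_closure
  obtain ⟨z₀, hz₀⟩ : Ω.Nonempty := closure_nonempty_iff.1 ⟨x₀, frontier_subset_closure hx₀⟩
  have hb₁ : 0 ≤ b₁ := (hV 0 z₀ hz₀).1.trans (hV 0 z₀ hz₀).2
  have hb₂ : 0 ≤ b₂ := (hW 0 z₀ hz₀).1.trans (hW 0 z₀ hz₀).2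
  -- the diameter constant
  obtain ⟨B, hB⟩ := hΩb.closure.exists_norm_le
  obtain ⟨D, hD1, hD⟩ : ∃ D : ℝ, 1 ≤ D ∧
      ∀ x ∈ closure Ω, ∀ y ∈ closure Ω, ‖x - y‖ ^ 2 + 1 ≤ D ^ 2 := by
    refine ⟨2 * |B| + 1, by linarith [abs_nonneg B], fun x hx y hy => ?_⟩
    have h1 : ‖x - y‖ ≤ 2 * |B| := by
      have := norm_sub_le x y
      linarith [hB x hx, hB y hy, le_abs_self B]
    have h2 : ‖x - y‖ ^ 2 ≤ (2 * |B|) ^ 2 := by gcongr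
    nlinarith [abs_nonneg B]
  have hD0 : 0 < D := by linarith
  -- regularity of the right-hand sides
  have key : ∀ (b C : ℝ) (V : E2 → ℝ) (u v : E2 → ℝ), 0 ≤ b → ContDiffOn ℝ 2 u (closure Ω) →
      ContDiffOn ℝ 2 v (closure Ω) → (∀ x ∈ Ω, -lap u x = V x * Real.exp (v x)) →
      (∀ x ∈ frontier Ω, u x = 0) →
      (∀ x ∈ Ω, 0 ≤ V x ∧ V x ≤ b) → (∫ x in Ω, Real.exp (v x)) ≤ C →
      (∀ x ∈ Ω, 0 ≤ -lap u x) ∧ (∀ x ∈ Ω, -lap u x ≤ b * Real.exp (v x)) ∧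
      IntegrableOn (fun x => -lap u x) Ω ∧ (∫ x in Ω, -lap u x) ≤ b * C ∧
      (∀ x ∈ closure Ω, 0 ≤ u x) ∧
      ∃ ε > 0, ε ≤ 1 ∧ ∀ x ∈ Ω, u x ≤ 1 + 1 / (2 * π) * ∫ y in Ω, Lk D ε (x - y) * (-lap u y) := by
    intro b C V u v hb hu hv heq hbd hV hI
    have h0 : ∀ x ∈ Ω, 0 ≤ -lap u x := fun x hx => by
      rw [heq x hx]; exact mul_nonneg (hV x hx).1 (Real.exp_pos _).le
    have h1 : ∀ x ∈ Ω, -lap u x ≤ b * Real.exp (v x) := fun x hx => by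
      rw [heq x hx]; exact mul_le_mul_of_nonneg_right (hV x hx).2 (Real.exp_pos _).le
    have hc : ContinuousOn (fun x => -lap u x) Ω :=
      (lap_continuousOn hΩo (hu.mono subset_closure)).neg
    have hei : IntegrableOn (fun x => b * Real.exp (v x)) Ω := by
      have h2 : ContinuousOn (fun x => b * Real.exp (v x)) (closure Ω) :=
        continuousOn_const.mul hv.continuousOn.rexp
      exact (h2.integrableOn_compact hKc).mono_set subset_closure
    have hi : IntegrableOn (fun x => -lap u x) Ω := by
      refine Integrable.mono' hei (hc.aestronglyMeasurable hΩo.measurableSet) ?_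
      refine (ae_restrict_iff' hΩo.measurableSet).2 (Eventually.of_forall fun y hy => ?_)
      rw [Real.norm_of_nonneg (h0 y hy)]
      exact h1 y hy
    refine ⟨h0, h1, hi, ?_, nonneg_of_lap hΩo hΩb hu h0 hbd,
      potential_bound hΩo hΩb hD0 hD hu (fun x _ => rfl) h0 hc hi hbd⟩
    calc (∫ x in Ω, -lap u x) ≤ ∫ x in Ω, b * Real.exp (v x) :=
          setIntegral_mono_on hi hei hΩo.measurableSet h1
      _ = b * ∫ x in Ω, Real.exp (v x) := integral_const_mul _ _
      _ ≤ b * C := by gcongr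
  have keyu := fun i => key b₁ C₂ (V i) (u i) (v i) hb₁ (hureg i) (hvreg i) (hequ i) (hubd i)
    (hV i) (hIv i)
  have keyv := fun i => key b₂ C₁ (W i) (v i) (u i) hb₂ (hvreg i) (hureg i) (heqv i) (hvbd i)
    (hW i) (hIu i)
  have hexpi : ∀ (p : ℝ) (w : E2 → ℝ) (r : ℝ), ContDiffOn ℝ 2 w (closure Ω) →
      IntegrableOn (fun x => Real.exp (p * w x)) (ball x₀ r ∩ Ω) := by
    intro p w r hw
    have h2 : ContinuousOn (fun x => Real.exp (p * w x)) (closure Ω) :=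
      (continuousOn_const.mul hw.continuousOn).rexp
    exact (h2.integrableOn_compact hKc).mono_set (inter_subset_right.trans subset_closure)
  -- the radius
  obtain ⟨r₀, hr₀, hr₀m⟩ : ∃ r > (0:ℝ), μ₁ (closedBall x₀ r) < ENNReal.ofReal (4 * π) := by
    have h1 := tendsto_measure_cthickening_of_isCompact (μ := μ₁) (isCompact_singleton (x := x₀))
    have h2 := h1.eventually_lt_const hmass
    obtain ⟨δ, hδ, h3⟩ := Metric.eventually_nhds_iff.1 h2
    refine ⟨δ / 2, by positivity, ?_⟩
    have h4 := h3 (y := δ / 2) (by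
      rw [Real.dist_eq, sub_zero, abs_of_pos (by positivity)]; linarith)
    rwa [cthickening_singleton _ (by positivity)] at h4
  have hr₀' : μ₁.real (closedBall x₀ r₀) < 4 * π := ENNReal.toReal_lt_of_lt_ofReal hr₀m
  obtain ⟨m, hm1, hm2⟩ := exists_between hr₀'
  have hm0 : 0 < m := lt_of_le_of_lt measureReal_nonneg hm1
  obtain ⟨R, hR, hRr, hR1⟩ : ∃ R > (0:ℝ), 3 * R ≤ r₀ ∧ R ≤ 1 :=
    ⟨min (r₀ / 3) 1, by positivity, by linarith [min_le_left (r₀ / 3) 1], min_le_right _ _⟩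
  have hRD : R ≤ D := by linarith
  -- eventually small mass
  have hsmall : ∀ᶠ i in atTop, ∫ y in ball x₀ (2 * R) ∩ Ω, -lap (u i) y ≤ m := by
    set φ : E2 → ℝ := fun x => max 0 (min 1 (3 - dist x x₀ / R)) with hφ
    have hφc : Continuous φ := by
      have : R ≠ 0 := hR.ne'
      fun_prop
    have hφ0 : ∀ x, 0 ≤ φ x := fun x => le_max_left _ _
    have hφ1 : ∀ x, φ x ≤ 1 := fun x => max_le zero_le_one (min_le_left _ _)
    have hφball : ∀ x ∈ ball x₀ (2 * R), φ x = 1 := by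
      intro x hx
      have h1 : dist x x₀ / R < 2 := by rw [div_lt_iff₀ hR]; exact hx
      simp only [hφ]
      rw [min_eq_left (by linarith), max_eq_right zero_le_one]
    have hφout : ∀ x, x ∉ closedBall x₀ r₀ → φ x = 0 := by
      intro x hx
      rw [mem_closedBall, not_le] at hx
      have h1 : 3 < dist x x₀ / R := by rw [lt_div_iff₀ hR]; linarith
      simp only [hφ]
      exact max_eq_left ((min_le_right _ _).trans (by linarith))
    have hlim : ∫ x in closure Ω, φ x ∂μ₁ < m := by
      refine lt_of_le_of_lt ?_ hm1
      calc ∫ x in closure Ω, φ x ∂μ₁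
          ≤ ∫ x in closure Ω, (closedBall x₀ r₀).indicator (fun _ => (1:ℝ)) x ∂μ₁ := by
            apply integral_mono_of_nonneg (Eventually.of_forall hφ0)
            · exact (integrable_const (1:ℝ)).indicator measurableSet_closedBall
            · refine Eventually.of_forall fun x => ?_
              by_cases hx : x ∈ closedBall x₀ r₀
              · simp only [indicator_of_mem hx]; exact hφ1 x
              · simp only [indicator_of_notMem hx]; exact (hφout x hx).le
        _ = (μ₁.restrict (closure Ω)).real (closedBall x₀ r₀) := by
            rw [integral_indicator measurableSet_closedBall]; simp
        _ ≤ μ₁.real (closedBall x₀ r₀) := by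
            apply ENNReal.toReal_mono (measure_ne_top _ _)
            exact Measure.restrict_apply_le _ _
    filter_upwards [(hconv₁ φ hφc.continuousOn).eventually_lt_const hlim] with i hi
    refine le_trans ?_ hi.le
    have hfi := (keyu i).2.2.1
    have e1 : ∫ x in Ω, V i x * Real.exp (v i x) * φ x = ∫ x in Ω, φ x * (-lap (u i) x) := by
      apply setIntegral_congr_fun hΩo.measurableSet
      intro x hx
      simp only
      rw [hequ i x hx]; ring
    have e2 : ∫ y in ball x₀ (2 * R) ∩ Ω, -lap (u i) y
        = ∫ y in ball x₀ (2 * R) ∩ Ω, φ y * (-lap (u i) y) := by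
      apply setIntegral_congr_fun (measurableSet_ball.inter hΩo.measurableSet)
      intro x hx
      simp only
      rw [hφball x hx.1, one_mul]
    rw [e1, e2]
    apply setIntegral_mono_set
    · refine Integrable.bdd_mul (c := 1) hfi hφc.aestronglyMeasurable
        (Eventually.of_forall fun y => ?_)
      rw [Real.norm_of_nonneg (hφ0 y)]; exact hφ1 y
    · refine (ae_restrict_iff' hΩo.measurableSet).2 (Eventually.of_forall fun y hy => ?_)
      exact mul_nonneg (hφ0 y) ((keyu i).1 y hy)
    · exact inter_subset_right.eventuallyLE
  -- the three estimates
  obtain ⟨p, P, hp1, hexp⟩ := exp_step hΩo hD0 hD x₀ hR hRD (b₁ * C₂) hm0 hm2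
  obtain ⟨Cv, hCv⟩ := step_bound hΩo hD0 hD x₀ (R := R / 2) (by positivity) (by linarith)
    P (b₂ * C₁) hb₂ hp1
  obtain ⟨Cu, hCu⟩ := step_bound hΩo hD0 hD x₀ (R := R / 4) (by positivity) (by linarith)
    (volume.real (ball x₀ (R / 2)) * Real.exp (2 * Cv)) (b₁ * C₂) hb₁ (p := 2) (by norm_num)
  rw [show 2 * (R / 2) = R by ring] at hCv
  rw [show 2 * (R / 4) = R / 2 by ring] at hCu
  obtain ⟨n, hn⟩ := eventually_atTop.1 hsmall
  have hbig : ∀ i ≥ n, ∀ x ∈ ball x₀ (R / 4) ∩ Ω, u i x ≤ Cu ∧ v i x ≤ Cv := by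
    intro i hi x hx
    obtain ⟨hu0, hub, hui, huM, -, ε, hε, hε1, hupot⟩ := keyu i
    obtain ⟨hv0, hvb, hvi, hvM, -, ε', hε', hε1', hvpot⟩ := keyv i
    have hP := hexp ε hε hε1 (u i) (fun x => -lap (u i) x) hu0 hui huM (hn i hi)
      (hexpi p (u i) R (hureg i)) hupot
    have hvC := hCv ε' hε' hε1' (u i) (v i) (fun x => -lap (v i) x) hv0 hvi hvM
      (fun x hx => hvb x hx.2) (hexpi p (u i) R (hureg i)) hP hvpot
    have huC := hCu ε hε hε1 (v i) (u i) (fun x => -lap (u i) x) hu0 hui huM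
      (fun x hx => hub x hx.2) (hexpi 2 (v i) (R / 2) (hvreg i)) (by
        have hfin : volume (ball x₀ (R / 2) ∩ Ω) < ⊤ :=
          lt_of_le_of_lt (measure_mono inter_subset_left) measure_ball_lt_top
        calc ∫ x in ball x₀ (R / 2) ∩ Ω, Real.exp (2 * v i x)
            ≤ ∫ x in ball x₀ (R / 2) ∩ Ω, Real.exp (2 * Cv) := by
              apply setIntegral_mono_on (hexpi 2 (v i) (R / 2) (hvreg i))
                (integrableOn_const hfin.ne) (measurableSet_ball.inter hΩo.measurableSet)
              intro x hx
              have := hvC x hx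
              gcongr
          _ = volume.real (ball x₀ (R / 2) ∩ Ω) * Real.exp (2 * Cv) := by
              rw [setIntegral_const, smul_eq_mul]
          _ ≤ _ := by
              gcongr
              · exact measure_ball_lt_top.ne
              · exact inter_subset_left) hupot
    exact ⟨huC x hx, hvC x ⟨ball_subset_ball (by linarith) hx.1, hx.2⟩⟩
  -- finitely many remaining indices
  have hfin : ∀ i, ∃ B : ℝ, 0 ≤ B ∧ ∀ x ∈ closure Ω, |u i x| ≤ B ∧ |v i x| ≤ B := by
    intro i
    obtain ⟨B1, h1⟩ := hKc.exists_bound_of_continuousOn (hureg i).continuousOn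
    obtain ⟨B2, h2⟩ := hKc.exists_bound_of_continuousOn (hvreg i).continuousOn
    refine ⟨max 0 (max B1 B2), le_max_left _ _, fun x hx => ⟨?_, ?_⟩⟩
    · exact (h1 x hx).trans ((le_max_left _ _).trans (le_max_right _ _))
    · exact (h2 x hx).trans ((le_max_right _ _).trans (le_max_right _ _))
  choose Bd hBd0 hBd using hfin
  have hS0 : 0 ≤ ∑ i ∈ Finset.range n, Bd i := Finset.sum_nonneg fun i _ => hBd0 i
  refine ⟨R / 4, by positivity, |Cu| + |Cv| + ∑ i ∈ Finset.range n, Bd i, fun i x hx => ?_⟩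
  rcases lt_or_ge i n with hi | hi
  · have h1 : Bd i ≤ ∑ i ∈ Finset.range n, Bd i :=
      Finset.single_le_sum (fun j _ => hBd0 j) (Finset.mem_range.2 hi)
    have h2 := hBd i x hx.2
    constructor <;> linarith [abs_nonneg Cu, abs_nonneg Cv, h2.1, h2.2]
  · by_cases hxΩ : x ∈ Ω
    · have h1 := hbig i hi x ⟨hx.1, hxΩ⟩
      rw [abs_of_nonneg ((keyu i).2.2.2.2.1 x hx.2), abs_of_nonneg ((keyv i).2.2.2.2.1 x hx.2)]
      constructor <;>
        linarith [abs_nonneg Cu, abs_nonneg Cv, le_abs_self Cu, le_abs_self Cv, h1.1, h1.2]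
    · have hxf : x ∈ frontier Ω := by rw [hΩo.frontier_eq]; exact ⟨hx.2, hxΩ⟩
      rw [hubd i x hxf, hvbd i x hxf, abs_zero]
      constructor <;> positivity

/-- **Boundary small-mass regularity.** If `V_i e^{v_i} dx → μ₁` and `W_i e^{u_i} dx → μ₂`
weakly-* on `Ω̄` and a boundary point `x₀ ∈ ∂Ω` has `μ₁({x₀}) < 4π` or `μ₂({x₀}) < 4π`,
then `u_i` and `v_i` are uniformly bounded on `B_R(x₀) ∩ Ω̄` for some `R > 0`. -/
theorem boundary_small_mass_regularity (Ω : Set E2) (hΩo : IsOpen Ω)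
    (hΩb : Bornology.IsBounded Ω) (hΩs : SmoothBoundary Ω)
    (b₁ b₂ C₁ C₂ : ℝ) (V W u v : ℕ → E2 → ℝ)
    (hureg : ∀ i, ContDiffOn ℝ 2 (u i) (closure Ω))
    (hvreg : ∀ i, ContDiffOn ℝ 2 (v i) (closure Ω))
    (hequ : ∀ i, ∀ x ∈ Ω, -lap (u i) x = V i x * Real.exp (v i x))
    (heqv : ∀ i, ∀ x ∈ Ω, -lap (v i) x = W i x * Real.exp (u i x))
    (hubd : ∀ i, ∀ x ∈ frontier Ω, u i x = 0)
    (hvbd : ∀ i, ∀ x ∈ frontier Ω, v i x = 0)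
    (hV : ∀ i, ∀ x ∈ Ω, 0 ≤ V i x ∧ V i x ≤ b₁)
    (hW : ∀ i, ∀ x ∈ Ω, 0 ≤ W i x ∧ W i x ≤ b₂)
    (hIu : ∀ i, (∫ x in Ω, Real.exp (u i x)) ≤ C₁)
    (hIv : ∀ i, (∫ x in Ω, Real.exp (v i x)) ≤ C₂)
    (μ₁ μ₂ : Measure E2) [IsFiniteMeasure μ₁] [IsFiniteMeasure μ₂]
    (hconv₁ : ∀ φ : E2 → ℝ, ContinuousOn φ (closure Ω) →
      Tendsto (fun i => ∫ x in Ω, V i x * Real.exp (v i x) * φ x) atTop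
        (𝓝 (∫ x in closure Ω, φ x ∂μ₁)))
    (hconv₂ : ∀ φ : E2 → ℝ, ContinuousOn φ (closure Ω) →
      Tendsto (fun i => ∫ x in Ω, W i x * Real.exp (u i x) * φ x) atTop
        (𝓝 (∫ x in closure Ω, φ x ∂μ₂)))
    (x₀ : E2) (hx₀ : x₀ ∈ frontier Ω)
    (hmass : μ₁ {x₀} < ENNReal.ofReal (4 * π) ∨ μ₂ {x₀} < ENNReal.ofReal (4 * π)) :
    ∃ R > (0 : ℝ), ∃ C : ℝ, ∀ i, ∀ x ∈ Metric.ball x₀ R ∩ closure Ω,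
      |u i x| ≤ C ∧ |v i x| ≤ C := by
  rcases hmass with h | h
  · exact boundary_core Ω hΩo hΩb b₁ b₂ C₁ C₂ V W u v hureg hvreg hequ heqv hubd hvbd hV hW
      hIu hIv μ₁ hconv₁ x₀ hx₀ h
  · obtain ⟨R, hR, C, hC⟩ := boundary_core Ω hΩo hΩb b₂ b₁ C₂ C₁ W V v u hvreg hureg heqv hequ
      hvbd hubd hW hV hIv hIu μ₂ hconv₂ x₀ hx₀ h
    exact ⟨R, hR, C, fun i x hx => (hC i x hx).symm⟩
end
end

section
/- Let x₀ ∈ ℝ², R > 0, B = B_R(x₀) the open ball in ℝ², and let μ be a nonnegative finite Borel measure on B with μ({x₀}) ≥ 4π. Suppose z ∈ L¹(B) is nonnegative and satisfies -Δz = μ in the distributional sense, i.e. -∫_B z Δφ dx = ∫_B φ dμ for every φ ∈ C_c^∞(B). Then there exists a constant C such that z(x) ≥ -2 log|x - x₀| + C for almost every x in a neighborhood of x₀, and consequently ∫_B e^{z} dx = +∞. -/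
open MeasureTheory Real Filter Topology Metric Set
open scoped RealInnerProductSpace ENNReal NNReal

noncomputable section

def sT (t : ℝ) : ℝ := Real.smoothTransition (t - 1)

lemma sT_contDiff : ContDiff ℝ (⊤ : ℕ∞) sT :=
  Real.smoothTransition.contDiff.comp (contDiff_id.sub contDiff_const)

lemma sT_mono : Monotone sT := fun a b h => Real.smoothTransition.monotone (by linarith)

lemma sT_zero {t : ℝ} (h : t ≤ 1) : sT t = 0 :=
  Real.smoothTransition.zero_of_nonpos (by linarith)

lemma sT_one {t : ℝ} (h : 2 ≤ t) : sT t = 1 :=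
  Real.smoothTransition.one_of_one_le (by linarith)

lemma sT_nonneg (t : ℝ) : 0 ≤ sT t := Real.smoothTransition.nonneg _

def sτ (t : ℝ) : ℝ := deriv sT t

lemma sT_hasDerivAt (t : ℝ) : HasDerivAt sT (sτ t) t :=
  (sT_contDiff.differentiable (by simp)).differentiableAt.hasDerivAt

lemma sτ_cont : Continuous sτ := sT_contDiff.continuous_deriv (by norm_num)

lemma sτ_nonneg (t : ℝ) : 0 ≤ sτ t := sT_mono.deriv_nonneg

lemma sτ_zero {t : ℝ} (h : 2 < t) : sτ t = 0 := by
  have : sT =ᶠ[𝓝 t] fun _ => 1 := by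
    filter_upwards [lt_mem_nhds h] with s hs using sT_one hs.le
  unfold sτ
  rw [this.deriv_eq]; simp

lemma sτ_zero' {t : ℝ} (h : t < 1) : sτ t = 0 := by
  have : sT =ᶠ[𝓝 t] fun _ => 0 := by
    filter_upwards [gt_mem_nhds h] with s hs using sT_zero hs.le
  unfold sτ
  rw [this.deriv_eq]; simp

lemma sτ_bdd : ∃ M : ℝ, 0 < M ∧ ∀ t, sτ t ≤ M := by
  obtain ⟨M, hM⟩ := (isCompact_Icc (a := (1 : ℝ)) (b := 2)).exists_bound_of_continuousOn
    sτ_cont.continuousOn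
  refine ⟨max M 1, by positivity, fun t => ?_⟩
  by_cases h : t ∈ Icc (1 : ℝ) 2
  · exact (le_abs_self _).trans ((hM t h).trans (le_max_left _ _))
  · have : sτ t = 0 := by
      simp only [mem_Icc, not_and_or, not_le] at h
      rcases h with h | h
      · exact sτ_zero' h
      · exact sτ_zero h
    rw [this]; positivity

def sp (t : ℝ) : ℝ := sT t / (2 * t)

lemma sp_contDiff : ContDiff ℝ (⊤ : ℕ∞) sp := by
  rw [contDiff_iff_contDiffAt]
  intro t
  by_cases h : t < 1
  · have : sp =ᶠ[𝓝 t] fun _ => 0 := by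
      filter_upwards [gt_mem_nhds h] with s hs
      simp [sp, sT_zero (le_of_lt hs)]
    exact contDiffAt_const.congr_of_eventuallyEq this
  · exact sT_contDiff.contDiffAt.div (contDiffAt_const.mul contDiffAt_id)
      (by simp at h ⊢; linarith)

lemma sp_nonneg (t : ℝ) : 0 ≤ sp t := by
  by_cases h : t < 1
  · simp [sp, sT_zero (le_of_lt h)]
  · have := sT_nonneg t
    have : 0 < t := by linarith
    unfold sp; positivity

lemma mul_sp (t : ℝ) : t * sp t = sT t / 2 := by
  by_cases h : t = 0
  · simp [h, sT_zero (t := 0)]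
  · unfold sp; field_simp

def sA (t : ℝ) : ℝ := ∫ s in (0 : ℝ)..t, sp s

lemma sA_hasDerivAt (t : ℝ) : HasDerivAt sA (sp t) t :=
  intervalIntegral.integral_hasDerivAt_right (sp_contDiff.continuous.intervalIntegrable _ _)
    sp_contDiff.continuous.stronglyMeasurable.stronglyMeasurableAtFilter
    sp_contDiff.continuous.continuousAt

lemma sA_contDiff : ContDiff ℝ (⊤ : ℕ∞) sA := by
  rw [contDiff_infty_iff_deriv]
  refine ⟨fun t => (sA_hasDerivAt t).differentiableAt, ?_⟩
  have : deriv sA = sp := funext fun t => (sA_hasDerivAt t).deriv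
  rw [this]; exact sp_contDiff

lemma sA_zero : sA 0 = 0 := by simp [sA]

lemma sA_mono : Monotone sA :=
  monotone_of_hasDerivAt_nonneg sA_hasDerivAt sp_nonneg

lemma sA_log : ∃ c : ℝ, ∀ t, 2 ≤ t → sA t = Real.log t / 2 + c := by
  refine ⟨sA 2 - Real.log 2 / 2, fun t ht => ?_⟩
  have h : ∫ s in (2 : ℝ)..t, sp s = Real.log t / 2 - Real.log 2 / 2 := by
    refine intervalIntegral.integral_eq_sub_of_hasDerivAt (f := fun t => Real.log t / 2) ?_
      (sp_contDiff.continuous.intervalIntegrable _ _)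
    intro x hx
    rw [uIcc_of_le ht] at hx
    have hx0 : x ≠ 0 := by linarith [hx.1]
    refine ((Real.hasDerivAt_log hx0).div_const 2).congr_deriv ?_
    rw [sp, sT_one hx.1]; field_simp
  have h2 : sA 2 + ∫ s in (2 : ℝ)..t, sp s = sA t :=
    intervalIntegral.integral_add_adjacent_intervals
      (sp_contDiff.continuous.intervalIntegrable _ _)
      (sp_contDiff.continuous.intervalIntegrable _ _)
  linarith

/-- Radial profile. -/
def sF (r ε s : ℝ) : ℝ := sA (s / r ^ 2) - sA (s / ε ^ 2) + Real.log (r / ε)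

def sf (r ε s : ℝ) : ℝ := sp (s / r ^ 2) / r ^ 2 - sp (s / ε ^ 2) / ε ^ 2

lemma sF_hasDerivAt (r ε s : ℝ) : HasDerivAt (sF r ε) (sf r ε s) s := by
  have h (a : ℝ) : HasDerivAt (fun s => sA (s / a ^ 2)) (sp (s / a ^ 2) / a ^ 2) s := by
    have := (sA_hasDerivAt (s / a ^ 2)).comp s ((hasDerivAt_id s).div_const (a ^ 2))
    refine this.congr_deriv ?_
    simp [div_eq_mul_inv]
  exact ((h r).sub (h ε)).add_const _

lemma sF_contDiff (r ε : ℝ) : ContDiff ℝ (⊤ : ℕ∞) (sF r ε) :=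
  ((sA_contDiff.comp (contDiff_id.div_const _)).sub
    (sA_contDiff.comp (contDiff_id.div_const _))).add contDiff_const

lemma sf_contDiff (r ε : ℝ) : ContDiff ℝ (⊤ : ℕ∞) (sf r ε) :=
  ((sp_contDiff.comp (contDiff_id.div_const _)).div_const _).sub
    ((sp_contDiff.comp (contDiff_id.div_const _)).div_const _)

lemma mul_sf (r ε s : ℝ) :
    s * sf r ε s = (sT (s / r ^ 2) - sT (s / ε ^ 2)) / 2 := by
  have h1 := mul_sp (s / r ^ 2)
  have h2 := mul_sp (s / ε ^ 2)
  rw [sub_div, ← h1, ← h2, sf]; ring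

lemma sf_nonpos {r ε : ℝ} (hε : 0 < ε) (h : ε < r) {s : ℝ} (hs : 0 < s) : sf r ε s ≤ 0 := by
  have h1 := mul_sf r ε s
  have h2 : sT (s / r ^ 2) ≤ sT (s / ε ^ 2) := sT_mono (by gcongr)
  by_contra! h3
  nlinarith [mul_pos hs h3]

lemma sF_eq_zero {r ε : ℝ} (hε : 0 < ε) (h : ε < r) {s : ℝ} (hs : 2 * r ^ 2 ≤ s) :
    sF r ε s = 0 := by
  obtain ⟨c, hc⟩ := sA_log
  have hr : 0 < r := hε.trans h
  have hs0 : 0 < s := lt_of_lt_of_le (by positivity) hs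
  have hs2 : 2 * ε ^ 2 ≤ s := le_trans (by gcongr) hs
  unfold sF
  rw [hc _ (by rwa [le_div_iff₀ (by positivity)]), hc _ (by rwa [le_div_iff₀ (by positivity)]),
    Real.log_div hs0.ne' (by positivity), Real.log_div hs0.ne' (by positivity),
    Real.log_div hr.ne' hε.ne', Real.log_pow, Real.log_pow]
  push_cast; ring

lemma sF_nonneg {r ε : ℝ} (hε : 0 < ε) (h : ε < r) {s : ℝ} (hs : 0 ≤ s) : 0 ≤ sF r ε s := by
  have hr : 0 < r := hε.trans h
  have hanti : AntitoneOn (sF r ε) (Ici 0) := by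
    refine antitoneOn_of_deriv_nonpos (convex_Ici 0) (sF_contDiff r ε).continuous.continuousOn
      ((sF_contDiff r ε).differentiable (by simp)).differentiableOn ?_
    intro x hx
    rw [interior_Ici] at hx
    rw [(sF_hasDerivAt r ε x).deriv]
    exact sf_nonpos hε h hx
  have := hanti hs (show (0:ℝ) ≤ max s (2 * r ^ 2) by positivity) (le_max_left _ _)
  rwa [sF_eq_zero hε h (le_max_right _ _)] at this

lemma sF_lower : ∃ c : ℝ, ∀ r ε s : ℝ, 0 < ε → ε < r → 2 * ε ^ 2 ≤ s →
    Real.log r - Real.log s / 2 - c ≤ sF r ε s := by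
  obtain ⟨c, hc⟩ := sA_log
  refine ⟨c, fun r ε s hε h hs => ?_⟩
  have hr : 0 < r := hε.trans h
  have hs0 : 0 < s := lt_of_lt_of_le (by positivity) hs
  have : 0 ≤ sA (s / r ^ 2) := by
    rw [← sA_zero]; exact sA_mono (by positivity)
  unfold sF
  rw [hc (s / ε ^ 2) (by rwa [le_div_iff₀ (by positivity)]),
    Real.log_div hs0.ne' (by positivity),
    Real.log_div hr.ne' hε.ne', Real.log_pow]
  push_cast; linarith

/-- kernel -/
def sk (a : ℝ) (x : E2) : ℝ := 2 * sτ (‖x‖ ^ 2 / a ^ 2) / a ^ 2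

lemma lap_radial {r ε : ℝ} (hε : 0 < ε) (h : ε < r) (y x : E2) :
    lap (fun x => sF r ε (‖x - y‖ ^ 2)) x = sk r (x - y) - sk ε (x - y) := by
  have hr : 0 < r := hε.trans h
  have hn (x : E2) : HasFDerivAt (fun x : E2 => ‖x - y‖ ^ 2) (2 • innerSL ℝ (x - y)) x := by
    have := ((hasFDerivAt_id x).sub_const y).norm_sq
    simpa using this
  have h1 (i : Fin 2) (x : E2) : fderiv ℝ (fun x => sF r ε (‖x - y‖ ^ 2)) x
      (EuclideanSpace.single i 1) = sf r ε (‖x - y‖ ^ 2) * (2 * (x i - y i)) := by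
    have := ((sF_hasDerivAt r ε (‖x - y‖ ^ 2)).comp_hasFDerivAt x (hn x)).fderiv
    simp only [Function.comp_def] at this
    rw [this]
    simp [EuclideanSpace.inner_single_right]
  have hd (s : ℝ) : HasDerivAt (sf r ε) (deriv (sf r ε) s) s :=
    ((sf_contDiff r ε).differentiable (by simp)).differentiableAt.hasDerivAt
  have h2 (i : Fin 2) : fderiv ℝ (fun x : E2 => sf r ε (‖x - y‖ ^ 2) * (2 * (x i - y i))) x
      (EuclideanSpace.single i 1) = deriv (sf r ε) (‖x - y‖ ^ 2) * (2 * (x i - y i)) ^ 2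
        + 2 * sf r ε (‖x - y‖ ^ 2) := by
    have ha := ((hd (‖x - y‖ ^ 2)).comp_hasFDerivAt x (hn x))
    have hb : HasFDerivAt (fun x : E2 => 2 * (x i - y i))
      ((2 : ℝ) • (EuclideanSpace.proj i : E2 →L[ℝ] ℝ)) x :=
      (((EuclideanSpace.proj i : E2 →L[ℝ] ℝ).hasFDerivAt (x := x)).sub_const (y i)).const_mul 2
    have := (ha.mul hb).fderiv
    simp only [Function.comp_def] at this
    erw [this]
    simp [EuclideanSpace.inner_single_right]
    ring
  unfold lap
  simp only [h1, h2]
  have h3 : deriv (sf r ε) (‖x - y‖ ^ 2) * ‖x - y‖ ^ 2 + sf r ε (‖x - y‖ ^ 2) =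
      (sτ (‖x - y‖ ^ 2 / r ^ 2) / r ^ 2 - sτ (‖x - y‖ ^ 2 / ε ^ 2) / ε ^ 2) / 2 := by
    generalize ‖x - y‖ ^ 2 = s
    have e1 := (hasDerivAt_id s).mul (hd s)
    have e (a : ℝ) : HasDerivAt (fun s => sT (s / a ^ 2)) (sτ (s / a ^ 2) / a ^ 2) s := by
      have := (sT_hasDerivAt (s / a ^ 2)).comp s ((hasDerivAt_id s).div_const (a ^ 2))
      refine this.congr_deriv ?_
      simp [div_eq_mul_inv]
    have e2 := ((e r).sub (e ε)).div_const 2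
    have e3 : (id * sf r ε) = fun s => (sT (s / r ^ 2) - sT (s / ε ^ 2)) / 2 :=
      funext fun s => mul_sf r ε s
    rw [e3] at e1
    have := e1.unique e2
    simp at this
    linarith
  have h4 : ‖x - y‖ ^ 2 = (x 0 - y 0) ^ 2 + (x 1 - y 1) ^ 2 := by
    simp [EuclideanSpace.norm_sq_eq, Fin.sum_univ_two]
  simp only [Fin.sum_univ_two, sk]
  generalize hD : deriv (sf r ε) (‖x - y‖ ^ 2) = D at *
  generalize hG : sf r ε (‖x - y‖ ^ 2) = G at *
  have h5 : D * ((x 0 - y 0) ^ 2 + (x 1 - y 1) ^ 2) + G = 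
      (sτ (‖x - y‖ ^ 2 / r ^ 2) / r ^ 2 - sτ (‖x - y‖ ^ 2 / ε ^ 2) / ε ^ 2) / 2 := by
    rw [← h4]; exact h3
  linear_combination 4 * h5

lemma sk_cont (a : ℝ) : Continuous (sk a) := by
  have := sτ_cont
  unfold sk
  fun_prop

lemma sk_nonneg (a : ℝ) (x : E2) : 0 ≤ sk a x := by
  have := sτ_nonneg (‖x‖ ^ 2 / a ^ 2)
  unfold sk; positivity

lemma sk_bdd : ∃ M : ℝ, 0 < M ∧ ∀ a x, sk a x ≤ M / a ^ 2 := by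
  obtain ⟨M, hM, h⟩ := sτ_bdd
  refine ⟨2 * M, by positivity, fun a x => ?_⟩
  unfold sk
  have := h (‖x‖ ^ 2 / a ^ 2)
  gcongr

lemma sk_zero {a : ℝ} (ha : 0 < a) {x : E2} (hx : 2 * a < ‖x‖) : sk a x = 0 := by
  unfold sk
  rw [sτ_zero]
  · simp
  · rw [lt_div_iff₀ (by positivity)]
    nlinarith

lemma sk_compact {a : ℝ} (ha : 0 < a) : HasCompactSupport (sk a) := by
  refine HasCompactSupport.intro (isCompact_closedBall (0 : E2) (2 * a)) fun x hx => ?_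
  simp only [mem_closedBall, dist_zero_right, not_le] at hx
  exact sk_zero ha hx

lemma sk_integrable {a : ℝ} (ha : 0 < a) : Integrable (sk a) :=
  (sk_cont a).integrable_of_hasCompactSupport (sk_compact ha)

lemma sk_integral {a : ℝ} (ha : 0 < a) : ∫ x, sk a x = 2 * π := by
  have h := integral_fun_norm_addHaar (volume : Measure E2)
    (fun t : ℝ => 2 * sτ (t ^ 2 / a ^ 2) / a ^ 2)
  have h1 : ∫ x, sk a x = ∫ x : E2, (fun t : ℝ => 2 * sτ (t ^ 2 / a ^ 2) / a ^ 2) ‖x‖ := rfl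
  have hd : ∀ t ∈ Ici (0 : ℝ), HasDerivAt (fun t : ℝ => sT (t ^ 2 / a ^ 2))
      (t ^ (Module.finrank ℝ E2 - 1) • (2 * sτ (t ^ 2 / a ^ 2) / a ^ 2)) t := by
    intro t _
    have := (sT_hasDerivAt (t ^ 2 / a ^ 2)).comp t ((hasDerivAt_pow 2 t).div_const (a ^ 2))
    refine this.congr_deriv ?_
    simp
    ring
  have hlim : Tendsto (fun t : ℝ => sT (t ^ 2 / a ^ 2)) atTop (𝓝 1) := by
    refine tendsto_const_nhds.congr' ?_
    filter_upwards [eventually_ge_atTop (2 * a)] with t ht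
    rw [sT_one]
    rw [le_div_iff₀ (by positivity)]
    nlinarith
  have h2 := integral_Ioi_of_hasDerivAt_of_nonneg' hd (fun t ht => by
    have := sτ_nonneg (t ^ 2 / a ^ 2)
    have : (0 : ℝ) < t := ht
    positivity) hlim
  rw [h1, h, h2]
  have h3 : (volume : Measure E2).real (ball 0 1) = π := by
    simp [Measure.real, pi_pos.le]
  rw [h3]
  simp [sT_zero (t := 0)]

lemma sk_lebesgue {f : E2 → ℝ} (hf : Integrable f) : ∀ᵐ y : E2,
    Tendsto (fun ε : ℝ => ∫ x, f x * sk ε (x - y)) (𝓝[>] 0) (𝓝 (2 * π * f y)) := by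
  obtain ⟨M, hM, hMk⟩ := sk_bdd
  filter_upwards [IsUnifLocDoublingMeasure.ae_tendsto_average_norm_sub (volume : Measure E2)
    hf.locallyIntegrable 1] with y hy
  have hδ : Tendsto (fun ε : ℝ => 2 * ε) (𝓝[>] 0) (𝓝[>] 0) := by
    refine tendsto_nhdsWithin_iff.2 ⟨?_, ?_⟩
    · have : Tendsto (fun ε : ℝ => 2 * ε) (𝓝 0) (𝓝 (2 * 0)) :=
        (continuous_const.mul continuous_id).tendsto _
      rw [mul_zero] at this
      exact this.mono_left nhdsWithin_le_nhds
    · filter_upwards [self_mem_nhdsWithin] with ε hε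
      have : (0 : ℝ) < ε := hε
      simpa using this
  have key := hy (fun _ => y) (fun ε : ℝ => 2 * ε) hδ (by
    filter_upwards [self_mem_nhdsWithin] with ε hε
    have : (0 : ℝ) < ε := hε
    simp [this.le])
  have key2 := key.const_mul (M * (4 * π))
  rw [mul_zero] at key2
  rw [tendsto_iff_norm_sub_tendsto_zero]
  refine squeeze_zero' (Eventually.of_forall fun _ => norm_nonneg _) ?_ key2
  filter_upwards [self_mem_nhdsWithin] with ε hε
  have hε : (0 : ℝ) < ε := hε
  have hki : Integrable (fun x => sk ε (x - y)) := (sk_integrable hε).comp_sub_right y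
  have hkc : Continuous (fun x => sk ε (x - y)) := (sk_cont ε).comp (continuous_sub_right y)
  have hfk : Integrable (fun x => f x * sk ε (x - y)) := by
    refine hf.mul_bdd (c := M / ε ^ 2) hkc.aestronglyMeasurable ?_
    refine Eventually.of_forall fun x => ?_
    rw [Real.norm_of_nonneg (sk_nonneg _ _)]
    exact hMk _ _
  have e1 : ∫ x, f x * sk ε (x - y) - f y * sk ε (x - y) =
      (∫ x, f x * sk ε (x - y)) - 2 * π * f y := by
    rw [integral_sub hfk (hki.const_mul _), integral_const_mul,
      integral_sub_right_eq_self (sk ε) y, sk_integral hε]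
    ring
  rw [← e1]
  have hloc : IntegrableOn (fun x => ‖f x - f y‖) (closedBall y (2 * ε)) := by
    refine (hf.integrableOn.sub ?_).norm
    exact integrableOn_const measure_closedBall_lt_top.ne
  calc ‖∫ x, f x * sk ε (x - y) - f y * sk ε (x - y)‖
      ≤ ∫ x, ‖f x * sk ε (x - y) - f y * sk ε (x - y)‖ := norm_integral_le_integral_norm _
    _ = ∫ x in closedBall y (2 * ε), ‖f x * sk ε (x - y) - f y * sk ε (x - y)‖ := by
        symm
        refine setIntegral_eq_integral_of_forall_compl_eq_zero fun x hx => ?_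
        rw [mem_closedBall, not_le, dist_eq_norm] at hx
        simp [sk_zero hε hx]
    _ ≤ ∫ x in closedBall y (2 * ε), M / ε ^ 2 * ‖f x - f y‖ := by
        refine integral_mono (hfk.sub (hki.const_mul _)).norm.integrableOn (hloc.const_mul _) ?_
        intro x
        simp only
        rw [← sub_mul, norm_mul, mul_comm, Real.norm_of_nonneg (sk_nonneg _ _)]
        gcongr
        exact hMk _ _
    _ = M * (4 * π) * ⨍ x in closedBall y (2 * ε), ‖f x - f y‖ := by
        rw [integral_const_mul, setAverage_eq]
        have : (volume : Measure E2).real (closedBall y (2 * ε)) = 4 * ε ^ 2 * π := by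
          simp [Measure.real, pi_pos.le, hε.le]
          ring
        rw [this, smul_eq_mul]
        have := pi_pos
        field_simp

lemma lintegral_aux (x₀ : E2) {ρ : ℝ} (hρ : 0 < ρ) (C : ℝ) :
    ∫⁻ x in ball x₀ ρ, ENNReal.ofReal (Real.exp (-2 * Real.log ‖x - x₀‖ + C)) = ⊤ := by
  have h0 : ∫⁻ x in ball x₀ ρ, ENNReal.ofReal (Real.exp (-2 * Real.log ‖x - x₀‖ + C)) =
      ∫⁻ x in ball (0 : E2) ρ, ENNReal.ofReal (Real.exp (-2 * Real.log ‖x‖ + C)) := by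
    rw [← lintegral_indicator measurableSet_ball, ← lintegral_indicator measurableSet_ball,
      ← lintegral_add_right_eq_self _ x₀]
    congr 1; ext x
    simp [indicator, dist_eq_norm]
  rw [h0]
  by_contra hne
  have hint : IntegrableOn (fun x : E2 => (fun t : ℝ => Real.exp (-2 * Real.log t + C)) ‖x‖)
      (ball (0 : E2) ρ) := by
    refine ⟨?_, ?_⟩
    · refine Measurable.aestronglyMeasurable ?_
      fun_prop
    · rw [hasFiniteIntegral_iff_ofReal (Eventually.of_forall fun x => (Real.exp_pos _).le)]
      exact lt_top_iff_ne_top.2 hne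
  replace hint := (integrableOn_fun_norm_addHaar (volume : Measure E2)
    (f := fun t : ℝ => Real.exp (-2 * Real.log t + C))).1 hint
  have h2 : IntegrableOn (fun t : ℝ => t ^ (-1 : ℝ)) (Ioo 0 ρ) := by
    refine IntegrableOn.congr_fun (hint.const_mul (Real.exp (-C))) ?_ measurableSet_Ioo
    intro t ht
    have ht0 : 0 < t := ht.1
    have : Real.exp (-2 * Real.log t + C) = (t ^ 2)⁻¹ * Real.exp C := by
      rw [Real.exp_add]
      congr 1
      rw [← Real.exp_log (show 0 < (t ^ 2)⁻¹ by positivity), Real.log_inv, Real.log_pow]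
      push_cast; ring_nf
    simp only [this, finrank_euclideanSpace, Fintype.card_fin]
    rw [Real.rpow_neg_one, Real.exp_neg]
    simp
    field_simp
  rw [intervalIntegral.integrableOn_Ioo_rpow_iff hρ] at h2
  norm_num at h2

/-- **Logarithmic lower bound and non-integrability at a concentration point.** If a
nonnegative `z ∈ L¹(B)` solves `-Δz = μ` distributionally in `B = B_R(x₀) ⊂ ℝ²` with
`μ({x₀}) ≥ 4π`, then `z(x) ≥ -2 log |x - x₀| + C` a.e. near `x₀`, and `∫_B e^z = +∞`. -/
theorem log_lower_bound_of_mass (x₀ : E2) (R : ℝ) (hR : 0 < R)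
    (μ : Measure E2) [IsFiniteMeasure μ]
    (hmass : ENNReal.ofReal (4 * π) ≤ μ {x₀})
    (z : E2 → ℝ) (hz : IntegrableOn z (Metric.ball x₀ R))
    (hznn : ∀ x ∈ Metric.ball x₀ R, 0 ≤ z x)
    (heq : ∀ φ : E2 → ℝ, ContDiff ℝ (⊤ : ℕ∞) φ → HasCompactSupport φ →
      tsupport φ ⊆ Metric.ball x₀ R →
      -(∫ x in Metric.ball x₀ R, z x * lap φ x) = ∫ x in Metric.ball x₀ R, φ x ∂μ) :
    (∃ (C : ℝ) (ρ : ℝ), 0 < ρ ∧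
        ∀ᵐ x : E2, x ∈ Metric.ball x₀ ρ → -2 * Real.log ‖x - x₀‖ + C ≤ z x) ∧
      ∫⁻ x in Metric.ball x₀ R, ENNReal.ofReal (Real.exp (z x)) = ⊤ := by
  obtain ⟨c, hc⟩ := sF_lower
  obtain ⟨M, hM, hMk⟩ := sk_bdd
  have hfirst : ∃ (C : ℝ) (ρ : ℝ), 0 < ρ ∧ ρ ≤ R ∧
      ∀ᵐ x : E2, x ∈ Metric.ball x₀ ρ → -2 * Real.log ‖x - x₀‖ + C ≤ z x := by
    obtain ⟨r, hr⟩ : ∃ r : ℝ, r = R / 4 := ⟨_, rfl⟩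
    have hr0 : 0 < r := by rw [hr]; positivity
    refine ⟨2 * (Real.log r - c), r, hr0, by linarith, ?_⟩
    have hf : Integrable ((ball x₀ R).indicator z) :=
      (integrable_indicator_iff measurableSet_ball).2 hz
    filter_upwards [sk_lebesgue hf, Measure.ae_ne volume x₀] with y hy hyne hyr
    have hyR : y ∈ ball x₀ R := ball_subset_ball (by linarith) hyr
    rw [indicator_of_mem hyR] at hy
    have hd : 0 < ‖y - x₀‖ := by rw [norm_pos_iff, sub_ne_zero]; exact hyne
    have hclaim : ∀ᶠ ε in 𝓝[>] (0 : ℝ), 4 * π * (Real.log r - Real.log ‖y - x₀‖ - c) ≤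
        ∫ x, (ball x₀ R).indicator z x * sk ε (x - y) := by
      filter_upwards [self_mem_nhdsWithin, Ioo_mem_nhdsGT hr0, Ioo_mem_nhdsGT (half_pos hd)]
        with ε hε hεr hεd
      have hε : 0 < ε := hε
      have hεr := hεr.2
      have hεd := hεd.2
      have hφsm : ContDiff ℝ (⊤ : ℕ∞) (fun x : E2 => sF r ε (‖x - y‖ ^ 2)) :=
        (sF_contDiff r ε).comp ((contDiff_id.sub contDiff_const).norm_sq ℝ)
      have hzero : ∀ x : E2, x ∉ closedBall y (2 * r) → sF r ε (‖x - y‖ ^ 2) = 0 := by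
        intro x hx
        rw [mem_closedBall, not_le, dist_eq_norm] at hx
        exact sF_eq_zero hε hεr (by nlinarith)
      have hcs : HasCompactSupport (fun x : E2 => sF r ε (‖x - y‖ ^ 2)) :=
        HasCompactSupport.intro (isCompact_closedBall y (2 * r)) hzero
      have hsub : tsupport (fun x : E2 => sF r ε (‖x - y‖ ^ 2)) ⊆ ball x₀ R := by
        have h1 : tsupport (fun x : E2 => sF r ε (‖x - y‖ ^ 2)) ⊆ closedBall y (2 * r) := by
          refine closure_minimal ?_ isClosed_closedBall
          intro x hx
          by_contra h
          exact hx (hzero x h)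
        refine h1.trans (closedBall_subset_ball' ?_)
        have : dist y x₀ < r := hyr
        linarith
      have h := heq _ hφsm hcs hsub
      simp only [lap_radial hε hεr] at h
      have hzk (a : ℝ) : IntegrableOn (fun x => z x * sk a (x - y)) (ball x₀ R) := by
        refine Integrable.mul_bdd (c := M / a ^ 2) hz
          ((sk_cont a).comp (continuous_sub_right y)).aestronglyMeasurable ?_
        refine Eventually.of_forall fun x => ?_
        rw [Real.norm_of_nonneg (sk_nonneg _ _)]
        exact hMk _ _
      simp only [mul_sub] at h
      rw [integral_sub (hzk r) (hzk ε)] at h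
      have hpos : 0 ≤ ∫ x in ball x₀ R, z x * sk r (x - y) :=
        setIntegral_nonneg measurableSet_ball fun x hx => mul_nonneg (hznn x hx) (sk_nonneg _ _)
      have hI : ∫ x, (ball x₀ R).indicator z x * sk ε (x - y) =
          ∫ x in ball x₀ R, z x * sk ε (x - y) := by
        rw [← integral_indicator measurableSet_ball]
        congr 1; ext x
        by_cases hx : x ∈ ball x₀ R <;> simp [hx]
      rw [hI]
      have hφ0 : 0 ≤ sF r ε (‖x₀ - y‖ ^ 2) := sF_nonneg hε hεr (by positivity)
      have hμ : 4 * π * sF r ε (‖x₀ - y‖ ^ 2) ≤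
          ∫ x in ball x₀ R, sF r ε (‖x - y‖ ^ 2) ∂μ := by
        have hint : Integrable (fun x : E2 => sF r ε (‖x - y‖ ^ 2)) μ :=
          hφsm.continuous.integrable_of_hasCompactSupport hcs
        have h1 : ∫ x in {x₀}, sF r ε (‖x - y‖ ^ 2) ∂μ ≤
            ∫ x in ball x₀ R, sF r ε (‖x - y‖ ^ 2) ∂μ := by
          refine setIntegral_mono_set hint.integrableOn
            (Eventually.of_forall fun x => sF_nonneg hε hεr (by positivity)) ?_
          refine HasSubset.Subset.eventuallyLE ?_
          simpa using hR
        rw [integral_singleton, smul_eq_mul] at h1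
        refine le_trans ?_ h1
        gcongr
        rw [Measure.real, ← ENNReal.ofReal_le_iff_le_toReal (measure_ne_top _ _)]
        exact hmass
      have hlow := hc r ε (‖x₀ - y‖ ^ 2) hε hεr (by
        rw [norm_sub_rev]; nlinarith)
      rw [Real.log_pow, norm_sub_rev] at hlow
      push_cast at hlow
      rw [norm_sub_rev] at hμ
      have h4 : 4 * π * (Real.log r - Real.log ‖y - x₀‖ - c) ≤
          4 * π * sF r ε (‖y - x₀‖ ^ 2) := by
        gcongr
        linarith
      linarith
    have hle := ge_of_tendsto hy hclaim
    have h5 : 2 * π * (2 * (Real.log r - Real.log ‖y - x₀‖ - c)) ≤ 2 * π * z y := by linarith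
    have h6 := le_of_mul_le_mul_left h5 (by positivity)
    linarith
  obtain ⟨C, ρ, hρ, hρR, hae⟩ := hfirst
  refine ⟨⟨C, ρ, hρ, hae⟩, ?_⟩
  rw [eq_top_iff, ← lintegral_aux x₀ hρ C]
  refine le_trans (lintegral_mono_ae ?_) (lintegral_mono_set (ball_subset_ball hρR))
  rw [ae_restrict_iff' measurableSet_ball]
  filter_upwards [hae] with x hx hxb
  exact ENNReal.ofReal_le_ofReal (Real.exp_le_exp.2 (hx hxb))
end
end

section
/- Let Ω ⊂ ℝ² be a bounded open set with smooth boundary, let 0 < a ≤ b < +∞, and let K ⊂ Ω be compact. Then there exists c = c(a, b, K, Ω) such that for every V : Ω̄ → ℝ with a ≤ V ≤ b on Ω and every u ∈ C²(Ω̄) satisfying -Δu = V e^{u} in Ω and u = 0 on ∂Ω, one has sup_K u ≤ c. -/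
open MeasureTheory Real Filter Topology Metric Set
open scoped RealInnerProductSpace ENNReal NNReal

noncomputable section

/-- Differentiation under the integral sign, jointly continuous derivative. -/
lemma hasDerivAt_param (F F' : ℝ → ℝ → ℝ) (hF : Continuous (fun q : ℝ × ℝ => F q.1 q.2))
    (hF' : Continuous (fun q : ℝ × ℝ => F' q.1 q.2))
    (hd : ∀ t θ, HasDerivAt (fun s => F s θ) (F' t θ) t) (α β t : ℝ) :
    HasDerivAt (fun s => ∫ θ in α..β, F s θ) (∫ θ in α..β, F' t θ) t := by
  have hcomp : IsCompact ((Icc (t - 1) (t + 1)) ×ˢ (uIcc α β)) := isCompact_Icc.prod isCompact_uIcc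
  obtain ⟨C, hC⟩ := hcomp.exists_bound_of_continuousOn hF'.continuousOn
  have h1 : ∀ s, Continuous (F s) := fun s =>
    hF.comp (Continuous.prodMk continuous_const continuous_id)
  have h2 : ∀ s, Continuous (F' s) := fun s =>
    hF'.comp (Continuous.prodMk continuous_const continuous_id)
  refine (intervalIntegral.hasDerivAt_integral_of_dominated_loc_of_deriv_le (F := F) (F' := F')
    (s := Icc (t - 1) (t + 1)) (bound := fun _ => C) ?_ ?_ ?_ ?_ ?_ ?_ ?_).2
  · exact Icc_mem_nhds (by linarith) (by linarith)
  · exact Eventually.of_forall fun s => (h1 s).aestronglyMeasurable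
  · exact (h1 t).intervalIntegrable _ _
  · exact (h2 t).aestronglyMeasurable
  · exact Eventually.of_forall fun θ hθ s hs => hC (s, θ) ⟨hs, uIoc_subset_uIcc hθ⟩
  · exact intervalIntegrable_const
  · exact Eventually.of_forall fun θ _ s _ => hd s θ

/-- unit vectors -/
def ee (θ : ℝ) : E2 :=
  Real.cos θ • EuclideanSpace.single 0 1 + Real.sin θ • EuclideanSpace.single 1 1

def ep (θ : ℝ) : E2 :=
  (-Real.sin θ) • EuclideanSpace.single 0 1 + Real.cos θ • EuclideanSpace.single 1 1

lemma ee_norm (θ : ℝ) : ‖ee θ‖ = 1 := by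
  rw [EuclideanSpace.norm_eq]
  simp [ee, Fin.sum_univ_two]

lemma ee_deriv (θ : ℝ) : HasDerivAt ee (ep θ) θ :=
  ((Real.hasDerivAt_cos θ).smul_const _).add ((Real.hasDerivAt_sin θ).smul_const _)

lemma ep_deriv (θ : ℝ) : HasDerivAt ep (-ee θ) θ := by
  have h := ((Real.hasDerivAt_sin θ).neg.smul_const (EuclideanSpace.single 0 1 : E2)).add
    ((Real.hasDerivAt_cos θ).smul_const (EuclideanSpace.single 1 1 : E2))
  have he : -ee θ = (-Real.cos θ) • (EuclideanSpace.single 0 1 : E2) +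
      (-Real.sin θ) • (EuclideanSpace.single 1 1 : E2) := by
    simp only [ee]; module
  rw [he]; exact h

lemma ee_cont : Continuous ee := continuous_iff_continuousAt.2 fun θ => (ee_deriv θ).continuousAt
lemma ep_cont : Continuous ep := continuous_iff_continuousAt.2 fun θ => (ep_deriv θ).continuousAt

/-- log-polar coordinates -/
def PP (p : E2) (t θ : ℝ) : E2 := p + Real.exp t • ee θ

lemma PP_t (p : E2) (t θ : ℝ) : HasDerivAt (fun s => PP p s θ) (Real.exp t • ee θ) t :=
  ((Real.hasDerivAt_exp t).smul_const (ee θ)).const_add p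

lemma PP_θ (p : E2) (t θ : ℝ) : HasDerivAt (fun s => PP p t s) (Real.exp t • ep θ) θ :=
  ((ee_deriv θ).const_smul (Real.exp t)).const_add p

lemma PP_cont (p : E2) : Continuous (fun q : ℝ × ℝ => PP p q.1 q.2) := by
  unfold PP
  have := ee_cont
  fun_prop

lemma lap_eq (v : E2 → ℝ) (hv : ContDiff ℝ 2 v) (x : E2) (θ : ℝ) :
    fderiv ℝ (fderiv ℝ v) x (ee θ) (ee θ) + fderiv ℝ (fderiv ℝ v) x (ep θ) (ep θ) = lap v x := by
  have hd : DifferentiableAt ℝ (fderiv ℝ v) x :=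
    ((hv.fderiv_right (m := 1) (by norm_num)).differentiable (by norm_num)) x
  have h : ∀ w : E2, fderiv ℝ (fun y => fderiv ℝ v y w) x w = fderiv ℝ (fderiv ℝ v) x w w := by
    intro w
    rw [fderiv_clm_apply hd (differentiableAt_const w)]
    simp
  simp only [lap, Fin.sum_univ_two, h]
  simp only [ee, ep, map_add, map_smul, _root_.add_apply,
    _root_.smul_apply, smul_eq_mul]
  linear_combination (fderiv ℝ (fderiv ℝ v) x (EuclideanSpace.single 0 1) (EuclideanSpace.single 0 1)
    + fderiv ℝ (fderiv ℝ v) x (EuclideanSpace.single 1 1) (EuclideanSpace.single 1 1)) *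
    (Real.sin_sq_add_cos_sq θ)

lemma lap_cont (v : E2 → ℝ) (hv : ContDiff ℝ 2 v) : Continuous (lap v) := by
  have h2 : Continuous (fderiv ℝ (fderiv ℝ v)) :=
    (hv.fderiv_right (m := 1) (by norm_num)).continuous_fderiv (by norm_num)
  have : lap v = fun x => fderiv ℝ (fderiv ℝ v) x (ee 0) (ee 0) +
      fderiv ℝ (fderiv ℝ v) x (ep 0) (ep 0) := by
    funext x; rw [lap_eq v hv]
  rw [this]
  fun_prop

/-- circle averages -/
def AV (f : ℝ → ℝ) : ℝ := (2 * π)⁻¹ * ∫ θ in (0:ℝ)..(2 * π), f θ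

lemma AV_mono {f g : ℝ → ℝ} (hf : Continuous f) (hg : Continuous g) (h : ∀ θ, f θ ≤ g θ) :
    AV f ≤ AV g := by
  unfold AV
  have := Real.pi_pos
  gcongr
  exact intervalIntegral.integral_mono_on (by positivity) (hf.intervalIntegrable _ _)
    (hg.intervalIntegrable _ _) fun θ _ => h θ

lemma AV_const (c : ℝ) : AV (fun _ => c) = c := by
  unfold AV
  have := Real.pi_pos
  simp
  field_simp

lemma core (v : E2 → ℝ) (hv : ContDiff ℝ 2 v) (p : E2) : ∃ A1 : ℝ → ℝ,
    (∀ t, HasDerivAt (fun t => AV (fun θ => v (PP p t θ))) (A1 t) t) ∧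
    (∀ t, HasDerivAt A1 (AV (fun θ => Real.exp (2 * t) * lap v (PP p t θ))) t) ∧
    Tendsto (fun t => AV (fun θ => v (PP p t θ))) atBot (𝓝 (v p)) ∧
    Tendsto A1 atBot (𝓝 0) := by
  have hv0 : Continuous v := hv.continuous
  have hD : ContDiff ℝ 1 (fderiv ℝ v) := hv.fderiv_right (by norm_num)
  have hD0 : Continuous (fderiv ℝ v) := hD.continuous
  have hDD0 : Continuous (fderiv ℝ (fderiv ℝ v)) := hD.continuous_fderiv (by norm_num)
  have hPP := PP_cont p
  have hee := ee_cont
  have hep := ep_cont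
  have hdv : ∀ x, HasFDerivAt v (fderiv ℝ v x) x := fun x =>
    ((hv.differentiable (by norm_num)) x).hasFDerivAt
  have hddv : ∀ x, HasFDerivAt (fderiv ℝ v) (fderiv ℝ (fderiv ℝ v) x) x := fun x =>
    ((hD.differentiable (by norm_num)) x).hasFDerivAt
  have g1 : ∀ t θ, HasDerivAt (fun s => v (PP p s θ))
      (fderiv ℝ v (PP p t θ) (Real.exp t • ee θ)) t := fun t θ =>
    (hdv _).comp_hasDerivAt t (PP_t p t θ)
  have g2 : ∀ t θ, HasDerivAt (fun s => fderiv ℝ v (PP p s θ) (Real.exp s • ee θ))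
      (fderiv ℝ (fderiv ℝ v) (PP p t θ) (Real.exp t • ee θ) (Real.exp t • ee θ) +
        fderiv ℝ v (PP p t θ) (Real.exp t • ee θ)) t := fun t θ =>
    ((hddv _).comp_hasDerivAt t (PP_t p t θ)).clm_apply ((Real.hasDerivAt_exp t).smul_const (ee θ))
  have k2 : ∀ t θ, HasDerivAt (fun s => fderiv ℝ v (PP p t s) (Real.exp t • ep s))
      (fderiv ℝ (fderiv ℝ v) (PP p t θ) (Real.exp t • ep θ) (Real.exp t • ep θ) +
        fderiv ℝ v (PP p t θ) (Real.exp t • (- ee θ))) θ := fun t θ =>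
    ((hddv _).comp_hasDerivAt θ (PP_θ p t θ)).clm_apply ((ep_deriv θ).const_smul (Real.exp t))
  refine ⟨fun t => AV (fun θ => fderiv ℝ v (PP p t θ) (Real.exp t • ee θ)), ?_, ?_, ?_, ?_⟩
  · intro t
    refine (hasDerivAt_param _ _ ?_ ?_ g1 0 (2 * π) t).const_mul _ <;> fun_prop
  · intro t
    have h := (hasDerivAt_param _ _ (by fun_prop) (by fun_prop) g2 0 (2 * π) t).const_mul (2 * π)⁻¹
    refine h.congr_deriv ?_
    symm
    unfold AV
    congr 1
    have hz : ∫ θ in (0:ℝ)..(2 * π),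
        (fderiv ℝ (fderiv ℝ v) (PP p t θ) (Real.exp t • ep θ) (Real.exp t • ep θ) +
        fderiv ℝ v (PP p t θ) (Real.exp t • (- ee θ))) = 0 := by
      rw [intervalIntegral.integral_eq_sub_of_hasDerivAt (fun θ _ => k2 t θ)]
      · simp [PP, ee, ep]
      · apply Continuous.intervalIntegrable
        have : Continuous (fun θ => PP p t θ) := by unfold PP; fun_prop
        fun_prop
    have hc : Continuous (fun θ => PP p t θ) := by unfold PP; fun_prop
    refine Eq.trans ?_ ((congrArg _ hz).trans (add_zero _))
    rw [← intervalIntegral.integral_add]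
    · congr 1
      funext θ
      beta_reduce
      rw [← lap_eq v hv _ θ, show (2:ℝ) * t = t + t by ring, Real.exp_add]
      simp only [map_smul, map_neg, _root_.smul_apply, smul_eq_mul]
      ring
    · apply Continuous.intervalIntegrable; fun_prop
    · apply Continuous.intervalIntegrable; fun_prop
  · have hc : Continuous (fun r : ℝ => AV (fun θ => v (p + r • ee θ))) := by
      unfold AV
      exact continuous_const.mul (intervalIntegral.continuous_parametric_intervalIntegral_of_continuous'
        (by unfold Function.uncurry; fun_prop) _ _)
    have h := (hc.tendsto 0).comp Real.tendsto_exp_atBot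
    simpa [AV_const, Function.comp_def, PP] using h
  · have hc : Continuous (fun r : ℝ => AV (fun θ => fderiv ℝ v (p + r • ee θ) (r • ee θ))) := by
      unfold AV
      exact continuous_const.mul (intervalIntegral.continuous_parametric_intervalIntegral_of_continuous'
        (by unfold Function.uncurry; fun_prop) _ _)
    have h := (hc.tendsto 0).comp Real.tendsto_exp_atBot
    simpa [AV_const, Function.comp_def, PP] using h

lemma AV_affine {g : ℝ → ℝ} (hg : Continuous g) (α β : ℝ) :
    AV (fun θ => α + β * g θ) = α + β * AV g := by
  unfold AV
  have := Real.pi_pos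
  rw [intervalIntegral.integral_add intervalIntegrable_const
    ((hg.const_mul β).intervalIntegrable _ _), intervalIntegral.integral_const_mul]
  simp
  field_simp

lemma PP_mem (p : E2) (t θ : ℝ) : PP p t θ ∈ closedBall p (Real.exp t) := by
  simp [PP, norm_smul, ee_norm, abs_of_pos (Real.exp_pos t)]

lemma circ (Ω : Set E2) (hΩ : IsOpen Ω) (u : E2 → ℝ) (hu : ContDiffOn ℝ 2 u Ω) (p : E2) (ρ : ℝ)
    (hρ : 0 < ρ) (hb : closedBall p ρ ⊆ Ω) (a : ℝ)
    (ha : ∀ y ∈ Ω, a * Real.exp (u y) ≤ - lap u y) (ha0 : 0 < a) :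
    ∃ A A1 A2 : ℝ → ℝ, (∀ t, HasDerivAt A (A1 t) t) ∧ (∀ t, HasDerivAt A1 (A2 t) t) ∧
      Tendsto A atBot (𝓝 (u p)) ∧ Tendsto A1 atBot (𝓝 0) ∧
      ∀ t, Real.exp t ≤ ρ →
        (∀ c, (∀ y ∈ closedBall p (Real.exp t), c ≤ u y) → c ≤ A t) ∧
        (∀ c, (∀ y ∈ closedBall p (Real.exp t), c ≤ lap u y) → Real.exp (2 * t) * c ≤ A2 t) ∧
        A2 t ≤ - a * Real.exp (A t + 2 * t) := by
  obtain ⟨δ, hδ, hδΩ⟩ := (isCompact_closedBall p ρ).exists_cthickening_subset_open hΩ hb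
  have hbig : closedBall p (ρ + δ) ⊆ Ω := by
    rwa [cthickening_closedBall hδ.le hρ.le p, add_comm] at hδΩ
  let φ : ContDiffBump p := ⟨ρ + δ / 2, ρ + δ, by positivity, by linarith⟩
  let v : E2 → ℝ := fun y => φ y * u y
  have hv : ContDiff ℝ 2 v := by
    rw [contDiff_iff_contDiffAt]
    intro y
    by_cases hy : y ∈ Ω
    · exact φ.contDiff.contDiffAt.mul (hu.contDiffAt (hΩ.mem_nhds hy))
    · have hy' : y ∉ tsupport φ := by
        rw [φ.tsupport_eq]
        exact fun h => hy (hbig h)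
      have : v =ᶠ[𝓝 y] fun _ => 0 := by
        filter_upwards [notMem_tsupport_iff_eventuallyEq.1 hy'] with z hz
        simp [v, hz]
      exact contDiffAt_const.congr_of_eventuallyEq this
  have hvu : ∀ y ∈ ball p (ρ + δ / 2), v y = u y := fun y hy => by
    have : φ y = 1 := φ.one_of_mem_closedBall (ball_subset_closedBall hy)
    simp [v, this]
  have hlap : ∀ y ∈ ball p (ρ + δ / 2), lap v y = lap u y := fun y hy => by
    have h1 : v =ᶠ[𝓝 y] u := by
      filter_upwards [isOpen_ball.mem_nhds hy] with z hz using hvu z hz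
    have h2 := h1.fderiv (𝕜 := ℝ)
    unfold lap
    refine Finset.sum_congr rfl fun i _ => ?_
    have h3 : (fun z => fderiv ℝ v z (EuclideanSpace.single i 1)) =ᶠ[𝓝 y]
        (fun z => fderiv ℝ u z (EuclideanSpace.single i 1)) := by
      filter_upwards [h2] with z hz
      rw [hz]
    rw [h3.fderiv_eq]
  obtain ⟨A1, h1, h2, h3, h4⟩ := core v hv p
  refine ⟨_, A1, _, h1, h2, ?_, h4, ?_⟩
  · rwa [hvu p (mem_ball_self (by positivity))] at h3
  · intro t ht
    have hPP : ∀ θ, PP p t θ ∈ ball p (ρ + δ / 2) := fun θ => by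
      have := PP_mem p t θ
      rw [mem_closedBall] at this
      rw [mem_ball]; linarith
    have hPΩ : ∀ θ, PP p t θ ∈ Ω := fun θ =>
      hb (closedBall_subset_closedBall ht (PP_mem p t θ))
    have hPc : Continuous (fun θ => PP p t θ) := by
      have := ee_cont
      unfold PP; fun_prop
    have hvc : Continuous (fun θ => v (PP p t θ)) := hv.continuous.comp hPc
    have hlc : Continuous (fun θ => Real.exp (2 * t) * lap v (PP p t θ)) :=
      continuous_const.mul ((lap_cont v hv).comp hPc)
    refine ⟨fun c hc => ?_, fun c hc => ?_, ?_⟩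
    · rw [← AV_const c]
      refine AV_mono continuous_const hvc fun θ => ?_
      rw [hvu _ (hPP θ)]; exact hc _ (PP_mem p t θ)
    · rw [← AV_const (Real.exp (2 * t) * c)]
      refine AV_mono continuous_const hlc fun θ => ?_
      rw [hlap _ (hPP θ)]
      exact mul_le_mul_of_nonneg_left (hc _ (PP_mem p t θ)) (Real.exp_pos _).le
    · set m := AV (fun θ => v (PP p t θ)) with hm
      have key : AV (fun θ => Real.exp (2 * t) * lap v (PP p t θ)) ≤
          AV (fun θ => (- a * Real.exp (m + 2 * t) * (1 - m)) +
            (- a * Real.exp (m + 2 * t)) * v (PP p t θ)) := by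
        refine AV_mono hlc (by fun_prop) fun θ => ?_
        rw [hlap _ (hPP θ), hvu _ (hPP θ)]
        have e1 := ha _ (hPΩ θ)
        have e2 : Real.exp m * (1 + (u (PP p t θ) - m)) ≤ Real.exp (u (PP p t θ)) := by
          have := Real.add_one_le_exp (u (PP p t θ) - m)
          calc _ ≤ Real.exp m * Real.exp (u (PP p t θ) - m) := by
                gcongr; linarith
            _ = _ := by rw [← Real.exp_add]; congr 1; ring
        have e3 : lap u (PP p t θ) ≤ - a * (Real.exp m * (1 + (u (PP p t θ) - m))) := by
          have := mul_le_mul_of_nonneg_left e2 ha0.le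
          linarith
        have e4 := mul_le_mul_of_nonneg_left e3 (Real.exp_pos (2 * t)).le
        rw [Real.exp_add]
        linarith
      rw [AV_affine hvc, ← hm] at key
      linarith

lemma conv_mono (F F1 F2 : ℝ → ℝ) (h1 : ∀ t, HasDerivAt F (F1 t) t)
    (h2 : ∀ t, HasDerivAt F1 (F2 t) t) (s t : ℝ) (hst : s ≤ t) (h0 : 0 ≤ F1 s)
    (hp : ∀ r ∈ Icc s t, 0 ≤ F2 r) : F s ≤ F t := by
  have hF1 : MonotoneOn F1 (Icc s t) := by
    refine monotoneOn_of_deriv_nonneg (convex_Icc s t)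
      (fun x _ => (h2 x).continuousAt.continuousWithinAt)
      (fun x _ => (h2 x).differentiableAt.differentiableWithinAt) fun x hx => ?_
    rw [(h2 x).deriv]; exact hp x (interior_subset hx)
  have hF : MonotoneOn F (Icc s t) := by
    refine monotoneOn_of_deriv_nonneg (convex_Icc s t)
      (fun x _ => (h1 x).continuousAt.continuousWithinAt)
      (fun x _ => (h1 x).differentiableAt.differentiableWithinAt) fun x hx => ?_
    rw [(h1 x).deriv]
    have hx' := interior_subset hx
    exact h0.trans (hF1 (left_mem_Icc.2 hst) hx' hx'.1)
  exact hF (left_mem_Icc.2 hst) (right_mem_Icc.2 hst) hst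

lemma conv_bot (F F1 F2 : ℝ → ℝ) (h1 : ∀ t, HasDerivAt F (F1 t) t)
    (h2 : ∀ t, HasDerivAt F1 (F2 t) t) (t l : ℝ) (hl : Tendsto F atBot (𝓝 l))
    (hl1 : Tendsto F1 atBot (𝓝 0)) (hp : ∀ r ≤ t, 0 ≤ F2 r) : l ≤ F t ∧ 0 ≤ F1 t := by
  have hF1 : MonotoneOn F1 (Iic t) := by
    refine monotoneOn_of_deriv_nonneg (convex_Iic t)
      (fun x _ => (h2 x).continuousAt.continuousWithinAt)
      (fun x _ => (h2 x).differentiableAt.differentiableWithinAt) fun x hx => ?_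
    have hx' : x ∈ Iic t := interior_subset hx
    rw [(h2 x).deriv]; exact hp x hx'
  have h0 : ∀ s ≤ t, 0 ≤ F1 s := fun s hs => by
    refine le_of_tendsto hl1 ?_
    filter_upwards [eventually_le_atBot s] with r hr
    exact hF1 (mem_Iic.2 (hr.trans hs)) (mem_Iic.2 hs) hr
  refine ⟨?_, h0 t le_rfl⟩
  refine le_of_tendsto hl ?_
  filter_upwards [eventually_le_atBot t] with r hr
  exact conv_mono F F1 F2 h1 h2 r t hr (h0 r hr) fun q hq => hp q hq.2

lemma ode (W W1 W2 : ℝ → ℝ) (h1 : ∀ t, HasDerivAt W (W1 t) t)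
    (h2 : ∀ t, HasDerivAt W1 (W2 t) t) (a m t0 t2 : ℝ) (ha : 0 < a) (h02 : t0 ≤ t2)
    (hW : ∀ t ∈ Icc t0 t2, W2 t ≤ - a * Real.exp (W t)) (hl0 : m ≤ W t0) (hl2 : m ≤ W t2)
    (hu0 : W t0 ≤ 0) (hs : W1 t0 ≤ 2) :
    W t2 ≤ 2 * (t2 - t0) - a * Real.exp m * (t2 - t0) ^ 2 / 2 := by
  have hconc : ConcaveOn ℝ (Icc t0 t2) W := by
    refine concaveOn_of_hasDerivWithinAt2_nonpos (convex_Icc _ _)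
      (fun x _ => (h1 x).continuousAt.continuousWithinAt)
      (fun x _ => (h1 x).hasDerivWithinAt) (fun x _ => (h2 x).hasDerivWithinAt) fun x hx => ?_
    have := hW x (interior_subset hx)
    have := mul_pos ha (Real.exp_pos (W x))
    linarith
  have hlow : ∀ t ∈ Icc t0 t2, m ≤ W t := fun t ht =>
    (le_min hl0 hl2).trans (hconc.min_le_of_mem_Icc (left_mem_Icc.2 h02) (right_mem_Icc.2 h02) ht)
  set c := a * Real.exp m with hc
  have := conv_mono (fun t => 2 * (t - t0) - c * (t - t0) ^ 2 / 2 - W t)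
    (fun t => 2 - c * (t - t0) - W1 t) (fun t => - c - W2 t) (fun t => ?_) (fun t => ?_) t0 t2 h02
    (by simp; linarith) ?_
  · simp at this
    linarith
  · have hi := (hasDerivAt_id t).sub_const t0
    refine (((hi.const_mul 2).sub (((hi.pow 2).const_mul c).div_const 2)).sub (h1 t)).congr_deriv ?_
    simp; ring
  · have hi := (hasDerivAt_id t).sub_const t0
    refine (((hi.const_mul c).const_sub 2).sub (h2 t)).congr_deriv ?_
    simp
  · intro r hr
    have e1 := hW r hr
    have e2 := mul_le_mul_of_nonneg_left (Real.exp_le_exp.2 (hlow r hr)) ha.le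
    linarith

lemma A_le (A A1 A2 : ℝ → ℝ) (h1 : ∀ t, HasDerivAt A (A1 t) t)
    (h2 : ∀ t, HasDerivAt A1 (A2 t) t) (t l : ℝ) (hl : Tendsto A atBot (𝓝 l))
    (hl1 : Tendsto A1 atBot (𝓝 0)) (hp : ∀ r ≤ t, A2 r ≤ 0) : A t ≤ l ∧ A1 t ≤ 0 := by
  have := conv_bot (fun t => - A t) (fun t => - A1 t) (fun t => - A2 t) (fun t => (h1 t).neg)
    (fun t => (h2 t).neg) t (-l) hl.neg (by simpa using hl1.neg)
    (fun r hr => by have := hp r hr; linarith)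
  constructor <;> linarith [this.1, this.2]

lemma nonneg_sol (Ω : Set E2) (hΩ : IsOpen Ω) (hΩb : Bornology.IsBounded Ω) (u : E2 → ℝ)
    (hu : ContDiffOn ℝ 2 u (closure Ω)) (a : ℝ) (ha0 : 0 < a)
    (ha : ∀ y ∈ Ω, a * Real.exp (u y) ≤ - lap u y) (hf : ∀ x ∈ frontier Ω, u x = 0) :
    ∀ x ∈ Ω, 0 ≤ u x := by
  intro x hx
  have hcomp : IsCompact (closure Ω) := hΩb.isCompact_closure
  obtain ⟨p, hp, hmin⟩ := hcomp.exists_isMinOn ⟨x, subset_closure hx⟩ hu.continuousOn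
  have hpx : u p ≤ u x := hmin (subset_closure hx)
  by_cases hpΩ : p ∈ Ω
  · exfalso
    obtain ⟨ρ, hρ, hb⟩ := nhds_basis_closedBall.mem_iff.1 (hΩ.mem_nhds hpΩ)
    obtain ⟨A, A1, A2, h1, h2, h3, h4, h5⟩ :=
      circ Ω hΩ u (hu.mono subset_closure) p ρ hρ hb a ha ha0
    have hexp : ∀ t < Real.log ρ, Real.exp t ≤ ρ := fun t ht =>
      ((Real.lt_log_iff_exp_lt hρ).1 ht).le
    have hneg : ∀ t < Real.log ρ, A2 t < 0 := fun t ht => by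
      have e1 := (h5 t (hexp t ht)).2.2
      have e2 := mul_pos ha0 (Real.exp_pos (A t + 2 * t))
      linarith
    have hA : ∀ t < Real.log ρ, A t = u p := fun t ht => by
      refine le_antisymm (A_le A A1 A2 h1 h2 t _ h3 h4
        fun r hr => (hneg r (hr.trans_lt ht)).le).1 ?_
      refine (h5 t (hexp t ht)).1 _ fun y hy => ?_
      exact hmin (subset_closure (hb (closedBall_subset_closedBall (hexp t ht) hy)))
    have hA1 : ∀ t < Real.log ρ, A1 t = 0 := fun t ht => by
      have he : A =ᶠ[𝓝 t] fun _ => u p := by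
        filter_upwards [isOpen_Iio.mem_nhds ht] with s hs using hA s hs
      exact (h1 t).unique ((hasDerivAt_const t (u p)).congr_of_eventuallyEq he)
    have ht : Real.log ρ - 1 < Real.log ρ := by linarith
    have he : A1 =ᶠ[𝓝 (Real.log ρ - 1)] fun _ => 0 := by
      filter_upwards [isOpen_Iio.mem_nhds ht] with s hs using hA1 s hs
    have := (h2 _).unique ((hasDerivAt_const _ (0:ℝ)).congr_of_eventuallyEq he)
    exact (hneg _ ht).ne this
  · have : p ∈ frontier Ω := by
      rw [hΩ.frontier_eq]; exact ⟨hp, hpΩ⟩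
    rw [hf p this] at hpx
    exact hpx

/-- Bound at an (almost) maximum point. -/
lemma peak (Ω : Set E2) (hΩ : IsOpen Ω) (u : E2 → ℝ) (hu : ContDiffOn ℝ 2 u Ω) (a b : ℝ)
    (ha0 : 0 < a) (hb0 : 0 ≤ b) (ha : ∀ y ∈ Ω, a * Real.exp (u y) ≤ - lap u y)
    (hb : ∀ y ∈ Ω, - lap u y ≤ b * Real.exp (u y)) (hu0 : ∀ y ∈ Ω, 0 ≤ u y)
    (p : E2) (R : ℝ) (hR : 0 < R) (hball : closedBall p R ⊆ Ω) (r : ℝ)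
    (hr : Real.exp (- u p / 2) ≤ r) (hrR : r ≤ R)
    (hmax : ∀ y ∈ closedBall p r, Real.exp (u y) ≤ 4 * Real.exp (u p)) :
    u p ≤ 2 * (max 1 ((4 + 4 * |Real.log R|) / (a * Real.exp (min (-b) (2 * Real.log R))))
      - Real.log R) := by
  obtain ⟨A, A1, A2, h1, h2, h3, h4, h5⟩ := circ Ω hΩ u hu p R hR hball a ha ha0
  set t0 := - u p / 2 with ht0
  set t2 := Real.log R with ht2
  have hexp2 : Real.exp t2 = R := Real.exp_log hR
  have h02 : t0 ≤ t2 := by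
    rw [ht2, Real.le_log_iff_exp_le hR]; exact hr.trans hrR
  have hexp : ∀ t ≤ t2, Real.exp t ≤ R := fun t ht => by
    rw [← hexp2]; exact Real.exp_le_exp.2 ht
  have hneg : ∀ t ≤ t2, A2 t ≤ 0 := fun t ht => by
    have e1 := (h5 t (hexp t ht)).2.2
    have e2 := mul_pos ha0 (Real.exp_pos (A t + 2 * t))
    linarith
  have hup := A_le A A1 A2 h1 h2 t0 _ h3 h4 fun r hr => hneg r (hr.trans h02)
  -- lower bound at `t0`
  have hlow : u p - b ≤ A t0 := by
    have hE : ∀ t : ℝ, HasDerivAt (fun s : ℝ => Real.exp (2 * s)) (2 * Real.exp (2 * t)) t :=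
      fun t => by
        refine ((hasDerivAt_id t).const_mul 2).exp.congr_deriv ?_
        simp; ring
    have hlim : Tendsto (fun s : ℝ => Real.exp (2 * s)) atBot (𝓝 0) :=
      Real.tendsto_exp_atBot.comp (tendsto_id.const_mul_atBot (by norm_num))
    have hq := (conv_bot (fun t => A t + b * Real.exp (u p) * Real.exp (2 * t))
      (fun t => A1 t + b * Real.exp (u p) * (2 * Real.exp (2 * t)))
      (fun t => A2 t + b * Real.exp (u p) * (2 * (2 * Real.exp (2 * t))))
      (fun t => (h1 t).add ((hE t).const_mul _))
      (fun t => (h2 t).add (((hE t).const_mul 2).const_mul _)) t0 (u p)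
      (by simpa using h3.add (hlim.const_mul (b * Real.exp (u p))))
      (by simpa using h4.add ((hlim.const_mul 2).const_mul (b * Real.exp (u p))))
      (fun s hs => ?_)).1
    · have : Real.exp (u p) * Real.exp (2 * t0) = 1 := by
        rw [← Real.exp_add, ht0]; simp; ring
      simp only [mul_assoc, this] at hq
      linarith
    · have hsr : Real.exp s ≤ r := (Real.exp_le_exp.2 hs).trans hr
      have := (h5 s (hsr.trans hrR)).2.1 (- (4 * b * Real.exp (u p))) fun y hy => by
        have hy' := closedBall_subset_closedBall hsr hy
        have e1 := hb y (hball (closedBall_subset_closedBall hrR hy'))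
        have e2 := mul_le_mul_of_nonneg_left (hmax y hy') hb0
        linarith
      linarith
  have hA2 : 0 ≤ A t2 := (h5 t2 hexp2.le).1 0 fun y hy => hu0 y (hball (by rwa [hexp2] at hy))
  set m := min (-b) (2 * t2) with hm
  have hode := ode (fun t => A t + 2 * t) (fun t => A1 t + 2) A2
    (fun t => by
      refine ((h1 t).add ((hasDerivAt_id t).const_mul 2)).congr_deriv ?_
      simp)
    (fun t => (h2 t).add_const 2) a m t0 t2 ha0 h02
    (fun t ht => (h5 t (hexp t ht.2)).2.2)
    (by have := min_le_left (-b) (2 * t2); linarith)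
    (by have := min_le_right (-b) (2 * t2); linarith)
    (by linarith [hup.1]) (by linarith [hup.2])
  set c := a * Real.exp m with hc
  have hcpos : 0 < c := mul_pos ha0 (Real.exp_pos m)
  have hT : t2 - t0 ≤ max 1 ((4 + 4 * |t2|) / c) := by
    by_cases h : t2 - t0 ≤ 1
    · exact h.trans (le_max_left _ _)
    · refine le_trans ?_ (le_max_right _ _)
      push Not at h
      rw [le_div_iff₀ hcpos]
      have h6 : c * (t2 - t0) ^ 2 ≤ 4 * (t2 - t0) + 4 * |t2| := by
        have := neg_abs_le t2
        linarith
      have h7 : |t2| ≤ |t2| * (t2 - t0) := le_mul_of_one_le_right (abs_nonneg _) h.le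
      have h8 : (t2 - t0) * ((t2 - t0) * c) ≤ (t2 - t0) * (4 + 4 * |t2|) := by nlinarith
      exact le_of_mul_le_mul_left h8 (by linarith)
  linarith

/-- **Theorem A (Brezis–Merle).** Interior a priori bound for the Liouville equation
`-Δu = V e^u` with Dirichlet boundary condition and `0 < a ≤ V ≤ b`. -/
theorem brezis_merle_theoremA (Ω : Set E2) (hΩo : IsOpen Ω) (hΩb : Bornology.IsBounded Ω)
    (hΩs : SmoothBoundary Ω) (a b : ℝ) (ha : 0 < a) (hab : a ≤ b)
    (K : Set E2) (hK : IsCompact K) (hKΩ : K ⊆ Ω) :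
    ∃ c : ℝ, ∀ (V u : E2 → ℝ),
      ContDiffOn ℝ 2 u (closure Ω) →
      (∀ x ∈ Ω, a ≤ V x ∧ V x ≤ b) →
      (∀ x ∈ Ω, -lap u x = V x * Real.exp (u x)) →
      (∀ x ∈ frontier Ω, u x = 0) →
      ∀ x ∈ K, u x ≤ c := by
  obtain ⟨δ, hδ, hδΩ⟩ := hK.exists_cthickening_subset_open hΩo hKΩ
  set R := δ / 2 with hRdef
  have hR : 0 < R := by positivity
  refine ⟨max (2 * Real.log (2 / R)) (2 * (max 1 ((4 + 4 * |Real.log R|) /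
    (a * Real.exp (min (-b) (2 * Real.log R)))) - Real.log R)), ?_⟩
  intro V u hu hV heq hf x hx
  have hΩx : closedBall x δ ⊆ Ω := (closedBall_subset_cthickening hx δ).trans hδΩ
  have hla : ∀ y ∈ Ω, a * Real.exp (u y) ≤ - lap u y := fun y hy => by
    rw [heq y hy]; exact mul_le_mul_of_nonneg_right (hV y hy).1 (Real.exp_pos _).le
  have hlb : ∀ y ∈ Ω, - lap u y ≤ b * Real.exp (u y) := fun y hy => by
    rw [heq y hy]; exact mul_le_mul_of_nonneg_right (hV y hy).2 (Real.exp_pos _).le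
  have hu0 := nonneg_sol Ω hΩo hΩb u hu a ha hla hf
  have huΩ : ContDiffOn ℝ 2 u Ω := hu.mono subset_closure
  have hRδ : R ≤ δ := by linarith
  have huR : ContinuousOn u (closedBall x R) :=
    huΩ.continuousOn.mono ((closedBall_subset_closedBall hRδ).trans hΩx)
  have hcont : ContinuousOn (fun y => Real.exp (u y / 2) * (R - dist y x)) (closedBall x R) := by
    fun_prop
  obtain ⟨p, hp, hmax⟩ := (isCompact_closedBall x R).exists_isMaxOn
    ⟨x, mem_closedBall_self hR.le⟩ hcont
  have hmax' : ∀ y ∈ closedBall x R,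
      Real.exp (u y / 2) * (R - dist y x) ≤ Real.exp (u p / 2) * (R - dist p x) :=
    fun y hy => hmax hy
  have hxp := hmax' x (mem_closedBall_self hR.le)
  rw [dist_self, sub_zero] at hxp
  have hd : 0 < R - dist p x := by
    have h0 : 0 < Real.exp (u p / 2) * (R - dist p x) :=
      (mul_pos (Real.exp_pos _) hR).trans_le hxp
    exact (pos_iff_pos_of_mul_pos h0).1 (Real.exp_pos _)
  set d := R - dist p x with hddef
  have hdR : d ≤ R := by have := dist_nonneg (x := p) (y := x); linarith
  by_cases hc : Real.exp (- u p / 2) ≤ d / 2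
  · refine le_trans ?_ (le_max_right _ _)
    have hpb : closedBall p R ⊆ Ω := by
      refine (closedBall_subset_closedBall' ?_).trans hΩx
      rw [mem_closedBall] at hp
      linarith
    refine le_trans ?_ (peak Ω hΩo u huΩ a b ha (ha.le.trans hab) hla hlb hu0 p R hR hpb (d / 2)
      hc (by linarith) ?_)
    · have h1 : Real.exp (u x / 2) * R ≤ Real.exp (u p / 2) * R :=
        hxp.trans (mul_le_mul_of_nonneg_left hdR (Real.exp_pos _).le)
      have h2 := Real.exp_le_exp.1 (le_of_mul_le_mul_right h1 hR)
      linarith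
    · intro y hy
      rw [mem_closedBall] at hy
      have h1 := dist_triangle y p x
      have h2 : d / 2 ≤ R - dist y x := by linarith
      have h3 := hmax' y (by rw [mem_closedBall]; linarith)
      have h4 : Real.exp (u y / 2) * (d / 2) ≤ Real.exp (u p / 2) * d :=
        (mul_le_mul_of_nonneg_left h2 (Real.exp_pos _).le).trans h3
      have h5 : Real.exp (u y / 2) ≤ 2 * Real.exp (u p / 2) := by
        refine le_of_mul_le_mul_right (?_ : _ * (d / 2) ≤ _ * (d / 2)) (by linarith)
        linarith
      have e : ∀ s : ℝ, Real.exp s = Real.exp (s / 2) ^ 2 := fun s => by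
        rw [← Real.exp_nat_mul]; congr 1; push_cast; ring
      rw [e (u y), e (u p)]
      calc _ ≤ (2 * Real.exp (u p / 2)) ^ 2 := pow_le_pow_left₀ (Real.exp_pos _).le h5 2
        _ = _ := by ring
  · refine le_trans ?_ (le_max_left _ _)
    push Not at hc
    have h1 : Real.exp (u p / 2) * d ≤ 2 := by
      have h2 := mul_le_mul_of_nonneg_left hc.le (Real.exp_pos (u p / 2)).le
      rw [← Real.exp_add, show u p / 2 + - u p / 2 = 0 by ring, Real.exp_zero] at h2
      linarith
    have h2 : Real.exp (u x / 2) ≤ 2 / R := by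
      rw [le_div_iff₀ hR]; linarith
    have h3 := (Real.le_log_iff_exp_le (by positivity)).2 h2
    linarith
end
end
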